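/- arXiv:1402.4560 — 4 statements merged into one kernel-verified Lean document; each statement's English description precedes it below -/
import Mathlib

section
/- Theorem 1 (fixed-window version). Let T ∈ ℝ, 0 < δ < 1 and γ > 0. Let (u₁, ω₁, ψ₁) be a classical solution of the reduced axisymmetric Euler system on 𝒞_{δ,T} = {(r,z,t) : 1−δ < r < 1, −δ < z < δ, T−δ < t < T}. Suppose there exist functions U, Ω ∈ C¹(𝒟) and Ψ ∈ C²(𝒟) on the left half-plane 𝒟 such that for all (r,z,t) ∈ 𝒞_{δ,T}: u₁(r,z,t) = (T−t)^{−1+γ/2} U(R,Z), ω₁(r,z,t) = (T−t)^{−1} Ω(R,Z), ψ₁(r,z,t) = (T−t)^{−1+2γ} Ψ(R,Z), where R = (r−1)(T−t)^{−γ} and Z = z(T−t)^{−γ}. Assume the decay condition sup_{R ≤ 0} (|U(R,Z)| + |Ω(R,Z)|) → 0 as |Z| → ∞. Then u₁ ≡ 0 and ω₁ ≡ 0 on 𝒞_{δ,T}, and there exist constants a, b ∈ ℝ such that ψ₁(r,z,t) = a (T−t)^{−1+γ} z + b (T−t)^{−1+2γ} on 𝒞_{δ,T}. -/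
/-- Partial derivative in the first (radial) variable. -/
noncomputable def pdr (f : ℝ → ℝ → ℝ → ℝ) : ℝ → ℝ → ℝ → ℝ :=
  fun r z t => deriv (fun s => f s z t) r

/-- Partial derivative in the second (axial) variable. -/
noncomputable def pdz (f : ℝ → ℝ → ℝ → ℝ) : ℝ → ℝ → ℝ → ℝ :=
  fun r z t => deriv (fun s => f r s t) z

/-- Partial derivative in the time variable. -/
noncomputable def pdt (f : ℝ → ℝ → ℝ → ℝ) : ℝ → ℝ → ℝ → ℝ :=
  fun r z t => deriv (fun s => f r z s) t

open Filter Topology Set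

lemma lh_ode_pos (α : ℝ) (f : ℝ → ℝ) (hf : Differentiable ℝ f)
    (h : ∀ x, α * f x + x * deriv f x = 0) (hd : Tendsto f atTop (𝓝 0)) :
    ∀ x, 0 < x → f x = 0 := by
  have hder : ∀ x ∈ Ioi (0:ℝ), HasDerivAt (fun x => x ^ α * f x) 0 x := by
    intro x hx
    have hx' : (0:ℝ) < x := hx
    have h1 := (Real.hasDerivAt_rpow_const (p := α) (Or.inl hx'.ne')).mul (hf x).hasDerivAt
    refine h1.congr_deriv ?_
    have h2 : x ^ α = x ^ (α - 1) * x := by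
      rw [← Real.rpow_add_one hx'.ne']; ring_nf
    rw [h2]
    linear_combination (x ^ (α - 1)) * h x
  have hconst : ∀ x ∈ Ioi (0:ℝ), ∀ y ∈ Ioi (0:ℝ), x ^ α * f x = y ^ α * f y := by
    intro x hx y hy
    refine (isOpen_Ioi).is_const_of_deriv_eq_zero (isPreconnected_Ioi) (f := fun x => x ^ α * f x)
      ?_ ?_ hx hy
    · intro x hx; exact (hder x hx).differentiableAt.differentiableWithinAt
    · intro x hx; exact (hder x hx).deriv
  intro x hx
  have hz : x ^ α * f x = 0 := by
    rcases lt_or_ge 0 α with ha | ha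
    · have h1 : Tendsto (fun y : ℝ => y ^ α * f y) (𝓝[>] 0) (𝓝 ((0:ℝ) ^ α * f 0)) := by
        apply Tendsto.mono_left _ nhdsWithin_le_nhds
        exact ((Real.continuousAt_rpow_const 0 α (Or.inr ha.le)).mul hf.continuous.continuousAt)
      rw [Real.zero_rpow ha.ne', zero_mul] at h1
      have h2 : Tendsto (fun y : ℝ => y ^ α * f y) (𝓝[>] 0) (𝓝 (x ^ α * f x)) := by
        apply tendsto_const_nhds.congr'
        filter_upwards [self_mem_nhdsWithin] with y hy
        exact hconst x hx y hy
      exact tendsto_nhds_unique h2 h1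
    · have h1 : Tendsto (fun y : ℝ => y ^ α * f y) atTop (𝓝 0) := by
        apply squeeze_zero_norm' (a := fun y => |f y|) _ (by simpa using hd.abs)
        filter_upwards [eventually_ge_atTop 1] with y hy
        rw [norm_mul, Real.norm_eq_abs, Real.norm_eq_abs]
        have : |y ^ α| ≤ 1 := by
          rw [abs_of_nonneg (by positivity)]
          exact Real.rpow_le_one_of_one_le_of_nonpos hy ha
        nlinarith [abs_nonneg (f y)]
      have h2 : Tendsto (fun y : ℝ => y ^ α * f y) atTop (𝓝 (x ^ α * f x)) := by
        apply tendsto_const_nhds.congr'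
        filter_upwards [eventually_gt_atTop 0] with y hy
        exact hconst x hx y hy
      exact tendsto_nhds_unique h2 h1
  rcases mul_eq_zero.1 hz with h | h
  · exact absurd h (Real.rpow_pos_of_pos hx α).ne'
  · exact h

lemma lh_ode (α : ℝ) (f : ℝ → ℝ) (hf : Differentiable ℝ f)
    (h : ∀ x, α * f x + x * deriv f x = 0) (hd : Tendsto f atTop (𝓝 0))
    (hd' : Tendsto f atBot (𝓝 0)) : ∀ x, f x = 0 := by
  have hp := lh_ode_pos α f hf h hd
  have hn := lh_ode_pos α (fun x => f (-x)) (hf.comp differentiable_neg)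
    (by intro x; rw [deriv_comp_neg]; have := h (-x); linarith)
    (hd'.comp tendsto_neg_atTop_atBot)
  intro x
  rcases lt_trichotomy x 0 with hx | hx | hx
  · simpa using hn (-x) (by linarith)
  · subst hx
    have h1 : Tendsto f (𝓝[>] 0) (𝓝 (f 0)) := hf.continuous.continuousAt.tendsto.mono_left nhdsWithin_le_nhds
    have h2 : Tendsto f (𝓝[>] 0) (𝓝 0) := by
      apply tendsto_const_nhds.congr'
      filter_upwards [self_mem_nhdsWithin] with y hy
      exact (hp y hy).symm
    exact tendsto_nhds_unique h1 h2
  · exact hp x hx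

lemma lh_cmr (c : ℝ) (f : ℝ → ℝ) (x : ℝ) :
    deriv (fun y => f (y * c)) x = c * deriv f (x * c) := by
  have := deriv_comp_mul_left c f x
  simpa only [mul_comm, smul_eq_mul] using this

lemma lh_pdr (inC : ℝ → ℝ → ℝ → Prop) (ho : ∀ r z t, inC r z t → ∀ᶠ s in 𝓝 r, inC s z t)
    (f : ℝ → ℝ → ℝ → ℝ) (F : ℝ → ℝ → ℝ) (c m : ℝ → ℝ)
    (hf : ∀ r z t, inC r z t → f r z t = c t * F ((r - 1) * m t) (z * m t)) :
    ∀ r z t, inC r z t → pdr f r z t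
      = (c t * m t) * (fun R Z => deriv (fun R' => F R' Z) R) ((r - 1) * m t) (z * m t) := by
  intro r z t h
  have h1 : (fun s => f s z t) =ᶠ[𝓝 r] fun s => c t * F ((s - 1) * m t) (z * m t) := by
    filter_upwards [ho r z t h] with s hs using hf s z t hs
  unfold pdr
  rw [h1.deriv_eq, deriv_const_mul_field]
  have h2 := deriv_comp_sub_const (f := fun s => F (s * m t) (z * m t)) (1:ℝ) r
  have h3 := lh_cmr (m t) (fun s => F s (z * m t)) (r - 1)
  rw [h2, h3]; ring

lemma lh_pdz (inC : ℝ → ℝ → ℝ → Prop) (ho : ∀ r z t, inC r z t → ∀ᶠ s in 𝓝 z, inC r s t)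
    (f : ℝ → ℝ → ℝ → ℝ) (F : ℝ → ℝ → ℝ) (c m : ℝ → ℝ)
    (hf : ∀ r z t, inC r z t → f r z t = c t * F ((r - 1) * m t) (z * m t)) :
    ∀ r z t, inC r z t → pdz f r z t
      = (c t * m t) * (fun R Z => deriv (fun Z' => F R Z') Z) ((r - 1) * m t) (z * m t) := by
  intro r z t h
  have h1 : (fun s => f r s t) =ᶠ[𝓝 z] fun s => c t * F ((r - 1) * m t) (s * m t) := by
    filter_upwards [ho r z t h] with s hs using hf r s t hs
  unfold pdz
  rw [h1.deriv_eq, deriv_const_mul_field]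
  have h3 := lh_cmr (m t) (fun s => F ((r - 1) * m t) s) z
  rw [h3]; ring

lemma lh_pdt (T γ p : ℝ) (inC : ℝ → ℝ → ℝ → Prop)
    (ho : ∀ r z t, inC r z t → ∀ᶠ s in 𝓝 t, inC r z s)
    (hT : ∀ r z t, inC r z t → t < T)
    (f : ℝ → ℝ → ℝ → ℝ) (F : ℝ → ℝ) (hF : Differentiable ℝ F)
    (hf : ∀ r z t, inC r z t → f r z t = (T - t) ^ p * F (z * (T - t) ^ (-γ))) :
    ∀ r z t, inC r z t → pdt f r z t
      = (T - t) ^ (p - 1) * (-p * F (z * (T - t) ^ (-γ))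
          + γ * (z * (T - t) ^ (-γ)) * deriv F (z * (T - t) ^ (-γ))) := by
  intro r z t h
  have hτ : 0 < T - t := by linarith [hT r z t h]
  have h1 : (fun s => f r z s) =ᶠ[𝓝 t] fun s => (T - s) ^ p * F (z * (T - s) ^ (-γ)) := by
    filter_upwards [ho r z t h] with s hs using hf r z s hs
  unfold pdt
  rw [h1.deriv_eq]
  have hpow : ∀ q : ℝ, HasDerivAt (fun s => (T - s) ^ q) (-1 * q * (T - t) ^ (q - 1)) t := by
    intro q
    exact ((hasDerivAt_id t).const_sub T).rpow_const (Or.inl hτ.ne')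
  have h2 := (hF (z * (T - t) ^ (-γ))).hasDerivAt.comp t ((hpow (-γ)).const_mul z)
  have h3 := ((hpow p).mul h2).deriv
  refine Eq.trans h3 ?_
  have e1 : (T - t) ^ p = (T - t) ^ (p - 1) * (T - t) := by
    rw [← Real.rpow_add_one hτ.ne']; ring_nf
  have e2 : (T - t) ^ (-γ) = (T - t) ^ (-γ - 1) * (T - t) := by
    rw [← Real.rpow_add_one hτ.ne']; ring_nf
  simp only [Function.comp]
  rw [e1]
  linear_combination (-(γ * z * (T - t) ^ (p - 1) * deriv F (z * (T - t) ^ (-γ)))) * e2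

lemma lh_lim (γ A B : ℝ) (hγ : 0 < γ) (h : ∀ᶠ τ in 𝓝[>] (0:ℝ), A + τ ^ γ * B = 0) : A = 0 := by
  have h1 : Tendsto (fun τ : ℝ => A + τ ^ γ * B) (𝓝[>] 0) (𝓝 (A + (0:ℝ) ^ γ * B)) := by
    apply Tendsto.mono_left _ nhdsWithin_le_nhds
    exact tendsto_const_nhds.add
      ((Real.continuousAt_rpow_const 0 γ (Or.inr hγ.le)).tendsto.mul_const B)
  rw [Real.zero_rpow hγ.ne', zero_mul, add_zero] at h1
  have h2 : Tendsto (fun τ : ℝ => A + τ ^ γ * B) (𝓝[>] 0) (𝓝 0) :=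
    tendsto_const_nhds.congr' (by filter_upwards [h] with τ hτ using hτ.symm)
  exact tendsto_nhds_unique h1 h2

/-- **Theorem 1 (fixed-window version).**
Let `T ∈ ℝ`, `0 < δ < 1`, `γ > 0`.  Let `(u₁, ω₁, ψ₁)` be a classical solution of the
reduced axisymmetric Euler system on
`𝒞_{δ,T} = {(r,z,t) : 1−δ < r < 1, −δ < z < δ, T−δ < t < T}`.  Suppose there are
profiles `U, Ω ∈ C¹(𝒟)`, `Ψ ∈ C²(𝒟)` on the closed left half-plane
`𝒟 = {(R,Z) : R ≤ 0}` with, on `𝒞_{δ,T}` (real powers, `R = (r−1)(T−t)^{−γ}`,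
`Z = z(T−t)^{−γ}`):
`u₁ = (T−t)^{−1+γ/2} U(R,Z)`, `ω₁ = (T−t)^{−1} Ω(R,Z)`, `ψ₁ = (T−t)^{−1+2γ} Ψ(R,Z)`.
Assume `sup_{R ≤ 0}(|U(R,Z)| + |Ω(R,Z)|) → 0` as `|Z| → ∞`.  Then `u₁ ≡ 0`, `ω₁ ≡ 0`
on `𝒞_{δ,T}`, and there are constants `a, b` with
`ψ₁(r,z,t) = a (T−t)^{−1+γ} z + b (T−t)^{−1+2γ}` on `𝒞_{δ,T}`. -/
theorem luo_hou_ansatz_trivial_fixed_window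
    (T δ γ : ℝ) (hδ0 : 0 < δ) (hδ1 : δ < 1) (hγ : 0 < γ)
    (u1 ω1 ψ1 : ℝ → ℝ → ℝ → ℝ) (U W Ψ : ℝ → ℝ → ℝ)
    (inC : ℝ → ℝ → ℝ → Prop)
    (hinC : ∀ r z t : ℝ, inC r z t ↔
      (1 - δ < r ∧ r < 1 ∧ -δ < z ∧ z < δ ∧ T - δ < t ∧ t < T))
    -- regularity of the classical solution: `u₁, ω₁` are `C¹`, `ψ₁` is `C¹` in all
    -- variables and `C²` in `(r,z)` for each fixed `t`
    (hu1reg : ContDiffOn ℝ 1 (fun q : ℝ × ℝ × ℝ => u1 q.1 q.2.1 q.2.2)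
      {q : ℝ × ℝ × ℝ | inC q.1 q.2.1 q.2.2})
    (hω1reg : ContDiffOn ℝ 1 (fun q : ℝ × ℝ × ℝ => ω1 q.1 q.2.1 q.2.2)
      {q : ℝ × ℝ × ℝ | inC q.1 q.2.1 q.2.2})
    (hψ1reg : ContDiffOn ℝ 1 (fun q : ℝ × ℝ × ℝ => ψ1 q.1 q.2.1 q.2.2)
      {q : ℝ × ℝ × ℝ | inC q.1 q.2.1 q.2.2})
    (hψ1reg2 : ∀ t : ℝ, ContDiffOn ℝ 2 (fun q : ℝ × ℝ => ψ1 q.1 q.2 t)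
      {q : ℝ × ℝ | 1 - δ < q.1 ∧ q.1 < 1 ∧ -δ < q.2 ∧ q.2 < δ})
    -- the reduced axisymmetric Euler system, with
    -- `uʳ = −r ∂_z ψ₁` and `u^z = 2ψ₁ + r ∂_r ψ₁`
    (heq1 : ∀ r z t : ℝ, inC r z t →
      pdt u1 r z t + (-(r * pdz ψ1 r z t)) * pdr u1 r z t
        + (2 * ψ1 r z t + r * pdr ψ1 r z t) * pdz u1 r z t
        = 2 * u1 r z t * pdz ψ1 r z t)
    (heq2 : ∀ r z t : ℝ, inC r z t →
      pdt ω1 r z t + (-(r * pdz ψ1 r z t)) * pdr ω1 r z t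
        + (2 * ψ1 r z t + r * pdr ψ1 r z t) * pdz ω1 r z t
        = pdz (fun a b c => (u1 a b c) ^ 2) r z t)
    (heq3 : ∀ r z t : ℝ, inC r z t →
      -(pdr (pdr ψ1) r z t + (3 / r) * pdr ψ1 r z t + pdz (pdz ψ1) r z t)
        = ω1 r z t)
    -- regularity of the blow-up profiles on the left half-plane
    (hUreg : ContDiffOn ℝ 1 (fun q : ℝ × ℝ => U q.1 q.2) {q : ℝ × ℝ | q.1 ≤ 0})
    (hWreg : ContDiffOn ℝ 1 (fun q : ℝ × ℝ => W q.1 q.2) {q : ℝ × ℝ | q.1 ≤ 0})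
    (hΨreg : ContDiffOn ℝ 2 (fun q : ℝ × ℝ => Ψ q.1 q.2) {q : ℝ × ℝ | q.1 ≤ 0})
    -- the self-similar ansatz
    (hrepu : ∀ r z t : ℝ, inC r z t →
      u1 r z t = (T - t) ^ (-1 + γ / 2) *
        U ((r - 1) * (T - t) ^ (-γ)) (z * (T - t) ^ (-γ)))
    (hrepω : ∀ r z t : ℝ, inC r z t →
      ω1 r z t = (T - t) ^ (-(1 : ℝ)) *
        W ((r - 1) * (T - t) ^ (-γ)) (z * (T - t) ^ (-γ)))
    (hrepψ : ∀ r z t : ℝ, inC r z t →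
      ψ1 r z t = (T - t) ^ (-1 + 2 * γ) *
        Ψ ((r - 1) * (T - t) ^ (-γ)) (z * (T - t) ^ (-γ)))
    -- decay condition: `sup_{R ≤ 0}(|U| + |Ω|) → 0` as `|Z| → ∞`
    (hdecay : ∀ ε > 0, ∃ M : ℝ, ∀ R ≤ (0 : ℝ), ∀ Z : ℝ,
      M < |Z| → |U R Z| + |W R Z| < ε) :
    (∀ r z t : ℝ, inC r z t → u1 r z t = 0 ∧ ω1 r z t = 0)
    ∧ ∃ a b : ℝ, ∀ r z t : ℝ, inC r z t →
        ψ1 r z t = a * (T - t) ^ (-1 + γ) * z + b * (T - t) ^ (-1 + 2 * γ) := by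
  -- openness
  have hoR : ∀ r z t, inC r z t → ∀ᶠ s in 𝓝 r, inC s z t := by
    intro r z t h
    rw [hinC] at h
    filter_upwards [Ioo_mem_nhds h.1 h.2.1] with s hs
    rw [hinC]; exact ⟨hs.1, hs.2, h.2.2⟩
  have hoZ : ∀ r z t, inC r z t → ∀ᶠ s in 𝓝 z, inC r s t := by
    intro r z t h
    rw [hinC] at h
    filter_upwards [Ioo_mem_nhds h.2.2.1 h.2.2.2.1] with s hs
    rw [hinC]; exact ⟨h.1, h.2.1, hs.1, hs.2, h.2.2.2.2⟩
  have hoT : ∀ r z t, inC r z t → ∀ᶠ s in 𝓝 t, inC r z s := by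
    intro r z t h
    rw [hinC] at h
    filter_upwards [Ioo_mem_nhds h.2.2.2.2.1 h.2.2.2.2.2] with s hs
    rw [hinC]; exact ⟨h.1, h.2.1, h.2.2.1, h.2.2.2.1, hs.1, hs.2⟩
  have hltT : ∀ r z t, inC r z t → t < T := fun r z t h => ((hinC r z t).1 h).2.2.2.2.2
  have hRneg : ∀ r z t, inC r z t → (r - 1) * (T - t) ^ (-γ) < 0 := by
    intro r z t h
    have h1 := hltT r z t h
    have h2 := ((hinC r z t).1 h).2.1
    exact mul_neg_of_neg_of_pos (by linarith) (Real.rpow_pos_of_pos (by linarith) _)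
  -- open set in space-time
  have hopen : IsOpen {q : ℝ × ℝ × ℝ | inC q.1 q.2.1 q.2.2} := by
    have : {q : ℝ × ℝ × ℝ | inC q.1 q.2.1 q.2.2}
        = Ioo (1 - δ) 1 ×ˢ (Ioo (-δ) δ ×ˢ Ioo (T - δ) T) := by
      ext q
      simp only [mem_ofPred_eq, hinC, mem_prod, mem_Ioo]
      tauto
    rw [this]
    exact isOpen_Ioo.prod (isOpen_Ioo.prod isOpen_Ioo)
  have hmem : ∀ R < 0, ∀ Z : ℝ, ∀ᶠ τ in 𝓝[>] (0:ℝ), 0 < τ ∧ inC (1 + τ ^ γ * R) (τ ^ γ * Z) (T - τ) := by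
    intro R hR Z
    have hl : Tendsto (fun τ : ℝ => τ ^ γ) (𝓝[>] 0) (𝓝 0) := by
      have := (Real.continuousAt_rpow_const 0 γ (Or.inr hγ.le)).tendsto
      rw [Real.zero_rpow hγ.ne'] at this
      exact this.mono_left nhdsWithin_le_nhds
    have h1 := hl.mul_const R
    have h2 := hl.mul_const Z
    rw [zero_mul] at h1 h2
    filter_upwards [self_mem_nhdsWithin, h1.eventually (Ioi_mem_nhds (show -δ < 0 by linarith)),
      h2.eventually (Ioo_mem_nhds (show -δ < 0 by linarith) hδ0),
      nhdsWithin_le_nhds (Iio_mem_nhds hδ0)] with τ h0 h3 h4 h5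
    have h0' : (0:ℝ) < τ := h0
    have h5' : τ < δ := h5
    have h3' : -δ < τ ^ γ * R := h3
    have hp : τ ^ γ * R < 0 := mul_neg_of_pos_of_neg (Real.rpow_pos_of_pos h0' _) hR
    refine ⟨h0', ?_⟩
    rw [hinC]
    exact ⟨by linarith, by linarith, h4.1, h4.2, by linarith, by linarith⟩
  have hRZ : ∀ τ R : ℝ, 0 < τ → (1 + τ ^ γ * R - 1) * τ ^ (-γ) = R := by
    intro τ R h
    have : τ ^ γ * τ ^ (-γ) = 1 := by rw [← Real.rpow_add h]; simp
    linear_combination R * this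
  have hZZ : ∀ τ Z : ℝ, 0 < τ → (τ ^ γ * Z) * τ ^ (-γ) = Z := by
    intro τ Z h
    have : τ ^ γ * τ ^ (-γ) = 1 := by rw [← Real.rpow_add h]; simp
    linear_combination Z * this
  -- profile regularity
  have hnh : ∀ R < (0:ℝ), ∀ Z : ℝ, {q : ℝ × ℝ | q.1 ≤ 0} ∈ 𝓝 (R, Z) := by
    intro R hR Z
    filter_upwards [continuous_fst.continuousAt.preimage_mem_nhds (Iio_mem_nhds (show ((R, Z) : ℝ × ℝ).1 < 0 from hR))] with q hq
    exact le_of_lt hq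
  have hUd : ∀ R < 0, Differentiable ℝ (fun Z => U R Z) := by
    intro R hR Z
    have h1 := (hUreg.contDiffAt (hnh R hR Z)).differentiableAt (by norm_num)
    exact DifferentiableAt.comp (g := fun q : ℝ × ℝ => U q.1 q.2) (f := fun Z => (R, Z)) Z h1 (by fun_prop)
  have hWd : ∀ R < 0, Differentiable ℝ (fun Z => W R Z) := by
    intro R hR Z
    have h1 := (hWreg.contDiffAt (hnh R hR Z)).differentiableAt (by norm_num)
    exact DifferentiableAt.comp (g := fun q : ℝ × ℝ => W q.1 q.2) (f := fun Z => (R, Z)) Z h1 (by fun_prop)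
  have hΨdR : ∀ Z, ∀ R < 0, DifferentiableAt ℝ (fun R => Ψ R Z) R := by
    intro Z R hR
    have h1 := (hΨreg.contDiffAt (hnh R hR Z)).differentiableAt (by norm_num)
    exact DifferentiableAt.comp (g := fun q : ℝ × ℝ => Ψ q.1 q.2) (f := fun R => (R, Z)) R h1 (by fun_prop)
  have hg2 : ContDiff ℝ 2 (fun Z => Ψ (-1) Z) := by
    rw [contDiff_iff_contDiffAt]
    intro Z
    have h1 := (hΨreg.contDiffAt (hnh (-1) (by norm_num) Z))
    exact ContDiffAt.comp (g := fun q : ℝ × ℝ => Ψ q.1 q.2) (f := fun Z => ((-1:ℝ), Z)) Z h1 (by fun_prop)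
  -- step 1
  have hψr := lh_pdr inC hoR ψ1 Ψ (fun t => (T - t) ^ (-1 + 2 * γ)) (fun t => (T - t) ^ (-γ)) hrepψ
  have hψrr := lh_pdr inC hoR (pdr ψ1) (fun R Z => deriv (fun R' => Ψ R' Z) R) (fun t => (T - t) ^ (-1 + 2 * γ) * (T - t) ^ (-γ)) (fun t => (T - t) ^ (-γ)) hψr
  have hψz := lh_pdz inC hoZ ψ1 Ψ (fun t => (T - t) ^ (-1 + 2 * γ)) (fun t => (T - t) ^ (-γ)) hrepψ
  have hψzz := lh_pdz inC hoZ (pdz ψ1) (fun R Z => deriv (fun Z' => Ψ R Z') Z) (fun t => (T - t) ^ (-1 + 2 * γ) * (T - t) ^ (-γ)) (fun t => (T - t) ^ (-γ)) hψz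
  have hE3 : ∀ R < 0, ∀ Z, deriv (fun R' => Ψ R' Z) R = 0 ∧
      deriv (fun R' => deriv (fun R'' => Ψ R'' Z) R') R
        + deriv (fun Z' => deriv (fun Z'' => Ψ R Z'') Z') Z + W R Z = 0 := by
    intro R hR Z
    set P1 := deriv (fun R' => Ψ R' Z) R with hP1
    set A := deriv (fun R' => deriv (fun R'' => Ψ R'' Z) R') R
        + deriv (fun Z' => deriv (fun Z'' => Ψ R Z'') Z') Z + W R Z with hA
    have key : ∀ᶠ τ in 𝓝[>] (0:ℝ), 0 < τ ∧ A + τ ^ γ * (A * R + 3 * P1) = 0 := by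
      filter_upwards [hmem R hR Z] with τ ⟨h0, hC⟩
      refine ⟨h0, ?_⟩
      have h3 := heq3 _ _ _ hC
      have hr : 0 < 1 + τ ^ γ * R := by linarith [((hinC _ _ _).1 hC).1]
      rw [hψr _ _ _ hC, hψrr _ _ _ hC, hψzz _ _ _ hC, hrepω _ _ _ hC] at h3
      simp only [hRZ τ R h0, hZZ τ Z h0, sub_sub_cancel] at h3
      rw [← hP1] at h3
      have e1 : τ ^ (-1 + 2 * γ) * τ ^ (-γ) = τ ^ (-(1:ℝ)) * τ ^ γ := by
        rw [← Real.rpow_add h0, ← Real.rpow_add h0]; ring_nf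
      have e2 : τ ^ γ * τ ^ (-γ) = 1 := by rw [← Real.rpow_add h0]; simp
      have e3 : τ ^ (-(1:ℝ)) ≠ 0 := (Real.rpow_pos_of_pos h0 _).ne'
      rw [e1, mul_assoc (τ ^ (-(1:ℝ))) (τ ^ γ) (τ ^ (-γ)), e2] at h3
      apply mul_left_cancel₀ e3
      have hr3 : 3 / (1 + τ ^ γ * R) * (1 + τ ^ γ * R) = 3 := div_mul_cancel₀ _ hr.ne'
      rw [hA]
      linear_combination (-(1 + τ ^ γ * R)) * h3 - (τ ^ (-(1:ℝ)) * τ ^ γ * P1) * hr3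
    have hA0 : A = 0 := lh_lim γ _ _ hγ (key.mono fun τ h => h.2)
    obtain ⟨τ, h0, hk⟩ := key.exists
    rw [hA0] at hk
    have hp := Real.rpow_pos_of_pos h0 γ
    refine ⟨?_, hA0⟩
    rcases mul_eq_zero.1 (show τ ^ γ * P1 = 0 by linarith) with h | h
    · exact absurd h hp.ne'
    · exact h
  have hg : ∀ R < 0, ∀ Z, Ψ R Z = Ψ (-1) Z := by
    intro R hR Z
    refine (isOpen_Iio (a := (0:ℝ))).is_const_of_deriv_eq_zero isPreconnected_Iio (f := fun R => Ψ R Z)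
      ?_ ?_ hR (show (-1:ℝ) < 0 by norm_num)
    · intro x hx; exact (hΨdR Z x hx).differentiableWithinAt
    · intro x hx; exact (hE3 x hx Z).1
  obtain ⟨g, hgdef⟩ : ∃ g : ℝ → ℝ, g = fun Z => Ψ (-1) Z := ⟨_, rfl⟩
  rw [← hgdef] at hg2
  have hgeq : ∀ R < 0, (fun Z => Ψ R Z) = g := by
    intro R hR; rw [hgdef]; funext Z; exact hg R hR Z
  have hWg : ∀ R < 0, ∀ Z, W R Z = - deriv (deriv g) Z := by
    intro R hR Z
    have h := (hE3 R hR Z).2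
    have h1 : deriv (fun R' => deriv (fun R'' => Ψ R'' Z) R') R = 0 := by
      have : (fun R' => deriv (fun R'' => Ψ R'' Z) R') =ᶠ[𝓝 R] fun _ => 0 := by
        filter_upwards [Iio_mem_nhds hR] with s hs using (hE3 s hs Z).1
      rw [this.deriv_eq]; simp
    have h2 : (fun Z' => deriv (fun Z'' => Ψ R Z'') Z') = deriv g := by
      rw [← hgeq R hR]
    rw [h1, h2] at h
    linarith
  obtain ⟨w, hwdef⟩ : ∃ w : ℝ → ℝ, w = fun Z => W (-1) Z := ⟨_, rfl⟩
  have hweq : ∀ R < 0, ∀ Z, W R Z = w Z := by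
    intro R hR Z
    rw [hwdef, hWg R hR Z]; simp only; rw [hWg (-1) (by norm_num)]
  have hwd : Differentiable ℝ w := by rw [hwdef]; exact hWd (-1) (by norm_num)
  -- reduced representations
  have hψ' : ∀ r z t, inC r z t → ψ1 r z t = (T - t) ^ (-1 + 2 * γ) * (fun _ Z => g Z) ((r - 1) * (T - t) ^ (-γ)) (z * (T - t) ^ (-γ)) := by
    intro r z t h
    rw [hrepψ r z t h, ← hgeq _ (hRneg r z t h)]
  have hω' : ∀ r z t, inC r z t → ω1 r z t = (T - t) ^ (-(1:ℝ)) * (fun _ Z => w Z) ((r - 1) * (T - t) ^ (-γ)) (z * (T - t) ^ (-γ)) := by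
    intro r z t h
    rw [hrepω r z t h, hweq _ (hRneg r z t h)]
  have hψr' := lh_pdr inC hoR ψ1 (fun _ Z => g Z) (fun t => (T - t) ^ (-1 + 2 * γ)) (fun t => (T - t) ^ (-γ)) hψ'
  have hψz' := lh_pdz inC hoZ ψ1 (fun _ Z => g Z) (fun t => (T - t) ^ (-1 + 2 * γ)) (fun t => (T - t) ^ (-γ)) hψ'
  have hωr' := lh_pdr inC hoR ω1 (fun _ Z => w Z) (fun t => (T - t) ^ (-(1:ℝ))) (fun t => (T - t) ^ (-γ)) hω'
  have hωz' := lh_pdz inC hoZ ω1 (fun _ Z => w Z) (fun t => (T - t) ^ (-(1:ℝ))) (fun t => (T - t) ^ (-γ)) hω'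
  have hωt' := lh_pdt T γ (-1) inC hoT hltT ω1 w hwd hω'
  have husq : ∀ r z t, inC r z t → (fun a b c => (u1 a b c) ^ 2) r z t = (T - t) ^ (-2 + γ) * (fun R Z => (U R Z) ^ 2) ((r - 1) * (T - t) ^ (-γ)) (z * (T - t) ^ (-γ)) := by
    intro r z t h
    have h0 : 0 < T - t := by linarith [hltT r z t h]
    simp only
    rw [hrepu r z t h, mul_pow, pow_two ((T - t) ^ (-1 + γ / 2)), ← Real.rpow_add h0]
    ring_nf
  have husqz := lh_pdz inC hoZ (fun a b c => (u1 a b c) ^ 2) (fun R Z => (U R Z) ^ 2) (fun t => (T - t) ^ (-2 + γ)) (fun t => (T - t) ^ (-γ)) husq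
  have hE2 : ∀ R < 0, ∀ Z, ∀ᶠ τ in 𝓝[>] (0:ℝ),
      w Z + γ * Z * deriv w Z + τ ^ γ * (2 * g Z * deriv w Z) = deriv (fun Z => (U R Z) ^ 2) Z := by
    intro R hR Z
    filter_upwards [hmem R hR Z] with τ ⟨h0, hC⟩
    have h2 := heq2 _ _ _ hC
    rw [hψr' _ _ _ hC, hψz' _ _ _ hC, hωr' _ _ _ hC, hωz' _ _ _ hC, hωt' _ _ _ hC, hψ' _ _ _ hC,
      husqz _ _ _ hC] at h2
    simp only [hRZ τ R h0, hZZ τ Z h0, sub_sub_cancel, deriv_const] at h2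
    have e1 : τ ^ (-1 + 2 * γ) * (τ ^ (-(1:ℝ)) * τ ^ (-γ)) = τ ^ (-(2:ℝ)) * τ ^ γ := by
      rw [← Real.rpow_add h0, ← Real.rpow_add h0, ← Real.rpow_add h0]; ring_nf
    have e2 : τ ^ (-2 + γ) * τ ^ (-γ) = τ ^ (-(2:ℝ)) := by
      rw [← Real.rpow_add h0]; ring_nf
    have e3 : τ ^ (-(2:ℝ)) ≠ 0 := (Real.rpow_pos_of_pos h0 _).ne'
    have e4 : τ ^ ((-1:ℝ) - 1) = τ ^ (-(2:ℝ)) := by norm_num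
    rw [e2, e4] at h2
    apply mul_left_cancel₀ e3
    linear_combination h2 - 2 * g Z * deriv w Z * e1
  -- decay limits
  have hdecU : ∀ R ≤ 0, Tendsto (fun Z => U R Z) (cocompact ℝ) (𝓝 0) ∧
      Tendsto (fun Z => W R Z) (cocompact ℝ) (𝓝 0) := by
    intro R hR
    have hab : ∀ M : ℝ, ∀ᶠ Z in cocompact ℝ, M < |Z| := fun M =>
      (tendsto_norm_cocompact_atTop (E := ℝ)).eventually (eventually_gt_atTop M)
    constructor
    · rw [Metric.tendsto_nhds]
      intro ε hε
      obtain ⟨M, hM⟩ := hdecay ε hε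
      filter_upwards [hab M] with Z hZ
      rw [Real.dist_eq, sub_zero]
      linarith [hM R hR Z hZ, abs_nonneg (W R Z)]
    · rw [Metric.tendsto_nhds]
      intro ε hε
      obtain ⟨M, hM⟩ := hdecay ε hε
      filter_upwards [hab M] with Z hZ
      rw [Real.dist_eq, sub_zero]
      linarith [hM R hR Z hZ, abs_nonneg (U R Z)]
  have htop : (atTop : Filter ℝ) ≤ cocompact ℝ := by rw [cocompact_eq_atBot_atTop]; exact le_sup_right
  have hbot : (atBot : Filter ℝ) ≤ cocompact ℝ := by rw [cocompact_eq_atBot_atTop]; exact le_sup_left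
  obtain ⟨V, hVdef⟩ : ∃ V : ℝ → ℝ, V = fun Z => (U (-1) Z) ^ 2 := ⟨_, rfl⟩
  have hVd : Differentiable ℝ V := by rw [hVdef]; exact (hUd (-1) (by norm_num)).pow 2
  have hVlim : Tendsto V (cocompact ℝ) (𝓝 0) := by
    rw [hVdef]; simpa using (hdecU (-1) (by norm_num)).1.pow 2
  have hUV : ∀ R < 0, ∀ Z, (U R Z) ^ 2 = V Z := by
    intro R hR Z
    have hdd : Differentiable ℝ (fun Z => (U R Z) ^ 2 - V Z) := ((hUd R hR).pow 2).sub hVd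
    have hz : ∀ Z, deriv (fun Z => (U R Z) ^ 2 - V Z) Z = 0 := by
      intro Z
      have h1 : HasDerivAt (fun Z => (U R Z) ^ 2 - V Z) _ Z :=
        (((hUd R hR).pow 2) Z).hasDerivAt.sub (hVd Z).hasDerivAt
      rw [h1.deriv]
      obtain ⟨τ, ha, hb⟩ := ((hE2 R hR Z).and (hE2 (-1) (by norm_num) Z)).exists
      rw [hVdef]
      have : deriv ((fun Z => U R Z) ^ 2) Z = deriv (fun Z => (U R Z) ^ 2) Z := rfl
      rw [this, ← ha, ← hb]; ring
    have hc := is_const_of_deriv_eq_zero hdd hz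
    have hl : Tendsto (fun Z => (U R Z) ^ 2 - V Z) atTop (𝓝 0) := by
      have := ((hdecU R hR.le).1.pow 2).sub hVlim
      simpa using this.mono_left htop
    have hl2 : Tendsto (fun Z => (U R Z) ^ 2 - V Z) atTop (𝓝 ((U R Z) ^ 2 - V Z)) :=
      tendsto_const_nhds.congr (fun x => hc Z x)
    linarith [tendsto_nhds_unique hl2 hl]
  -- step 3
  have hu' : ∀ r z t, inC r z t → (fun a b c => (u1 a b c) ^ 2) r z t = (T - t) ^ (-2 + γ) * (fun _ Z => V Z) ((r - 1) * (T - t) ^ (-γ)) (z * (T - t) ^ (-γ)) := by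
    intro r z t h
    rw [husq r z t h]; simp only; rw [hUV _ (hRneg r z t h)]
  have hur' := lh_pdr inC hoR (fun a b c => (u1 a b c) ^ 2) (fun _ Z => V Z) (fun t => (T - t) ^ (-2 + γ)) (fun t => (T - t) ^ (-γ)) hu'
  have huz' := lh_pdz inC hoZ (fun a b c => (u1 a b c) ^ 2) (fun _ Z => V Z) (fun t => (T - t) ^ (-2 + γ)) (fun t => (T - t) ^ (-γ)) hu'
  have hut' := lh_pdt T γ (-2 + γ) inC hoT hltT (fun a b c => (u1 a b c) ^ 2) V hVd hu'
  have hudiff : ∀ r z t, inC r z t →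
      pdr (fun a b c => (u1 a b c) ^ 2) r z t = 2 * u1 r z t * pdr u1 r z t ∧
      pdz (fun a b c => (u1 a b c) ^ 2) r z t = 2 * u1 r z t * pdz u1 r z t ∧
      pdt (fun a b c => (u1 a b c) ^ 2) r z t = 2 * u1 r z t * pdt u1 r z t := by
    intro r z t h
    have hd := (hu1reg.contDiffAt (hopen.mem_nhds (show (r, z, t) ∈ {q : ℝ × ℝ × ℝ | inC q.1 q.2.1 q.2.2} from h))).differentiableAt (by norm_num)
    have d1 : DifferentiableAt ℝ (fun s => u1 s z t) r :=
      DifferentiableAt.comp (g := fun q : ℝ × ℝ × ℝ => u1 q.1 q.2.1 q.2.2) (f := fun s => (s, z, t)) r hd (by fun_prop)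
    have d2 : DifferentiableAt ℝ (fun s => u1 r s t) z :=
      DifferentiableAt.comp (g := fun q : ℝ × ℝ × ℝ => u1 q.1 q.2.1 q.2.2) (f := fun s => (r, s, t)) z hd (by fun_prop)
    have d3 : DifferentiableAt ℝ (fun s => u1 r z s) t :=
      DifferentiableAt.comp (g := fun q : ℝ × ℝ × ℝ => u1 q.1 q.2.1 q.2.2) (f := fun s => (r, z, s)) t hd (by fun_prop)
    refine ⟨?_, ?_, ?_⟩
    · refine Eq.trans (d1.hasDerivAt.pow 2).deriv ?_
      simp [pdr, pdz, pdt]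
    · refine Eq.trans (d2.hasDerivAt.pow 2).deriv ?_
      simp [pdr, pdz, pdt]
    · refine Eq.trans (d3.hasDerivAt.pow 2).deriv ?_
      simp [pdr, pdz, pdt]
  have hE1 : ∀ Z, (2 - γ) * V Z + γ * Z * deriv V Z = 0 := by
    intro Z
    apply lh_lim γ _ (2 * g Z * deriv V Z - 4 * V Z * deriv g Z) hγ
    filter_upwards [hmem (-1) (by norm_num) Z] with τ ⟨h0, hC⟩
    have h1 := heq1 _ _ _ hC
    obtain ⟨k1, k2, k3⟩ := hudiff _ _ _ hC
    have hv := hu' _ _ _ hC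
    rw [hur' _ _ _ hC] at k1
    rw [huz' _ _ _ hC] at k2
    rw [hut' _ _ _ hC] at k3
    rw [hψr' _ _ _ hC, hψz' _ _ _ hC, hψ' _ _ _ hC] at h1
    simp only [hRZ τ (-1) h0, hZZ τ Z h0, sub_sub_cancel, deriv_const] at h1 k1 k2 k3 hv
    have e1 : τ ^ (-1 + 2 * γ) * (τ ^ (-2 + γ) * τ ^ (-γ)) = τ ^ (-3 + γ) * τ ^ γ := by
      rw [← Real.rpow_add h0, ← Real.rpow_add h0, ← Real.rpow_add h0]; ring_nf
    have e2 : τ ^ (-2 + γ) * (τ ^ (-1 + 2 * γ) * τ ^ (-γ)) = τ ^ (-3 + γ) * τ ^ γ := by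
      rw [← Real.rpow_add h0, ← Real.rpow_add h0, ← Real.rpow_add h0]; ring_nf
    have e3 : τ ^ (-3 + γ) ≠ 0 := (Real.rpow_pos_of_pos h0 _).ne'
    have e4 : τ ^ (-2 + γ - 1) = τ ^ (-3 + γ) := by ring_nf
    rw [e4] at k3
    apply mul_left_cancel₀ e3
    obtain ⟨u, hu⟩ : ∃ u, u = u1 (1 + τ ^ γ * -1) (τ ^ γ * Z) (T - τ) := ⟨_, rfl⟩
    rw [← hu] at h1 k1 k2 k3 hv
    generalize pdr u1 (1 + τ ^ γ * -1) (τ ^ γ * Z) (T - τ) = ur at *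
    generalize pdz u1 (1 + τ ^ γ * -1) (τ ^ γ * Z) (T - τ) = uz at *
    generalize pdt u1 (1 + τ ^ γ * -1) (τ ^ γ * Z) (T - τ) = ut at *
    have h1' := congrArg (fun x => 2 * u * x) h1
    have hη : deriv (fun Z => g Z) Z = deriv g Z := rfl
    linear_combination h1' + k3 + (2 * τ ^ (-1 + 2 * γ) * g Z) * k2
      - ((1 + τ ^ γ * -1) * (τ ^ (-1 + 2 * γ) * τ ^ (-γ) * deriv g Z)) * k1
      + (4 * (τ ^ (-1 + 2 * γ) * τ ^ (-γ) * deriv g Z)) * hv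
      - 2 * g Z * deriv V Z * e1 + 4 * V Z * deriv g Z * e2
  have hV0 : ∀ Z, V Z = 0 := by
    refine lh_ode ((2 - γ) / γ) V hVd ?_ (hVlim.mono_left htop) (hVlim.mono_left hbot)
    intro x
    have := hE1 x
    field_simp
    linarith
  have hU0 : ∀ R < 0, ∀ Z, U R Z = 0 := by
    intro R hR Z
    have := hUV R hR Z
    rw [hV0 Z] at this
    exact pow_eq_zero_iff (two_ne_zero) |>.1 this
  have hw0 : ∀ Z, w Z = 0 := by
    have hwl := (hdecU (-1) (by norm_num)).2
    rw [show (fun Z => W (-1) Z) = w from hwdef.symm] at hwl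
    refine lh_ode (1 / γ) w hwd ?_ (hwl.mono_left htop) (hwl.mono_left hbot)
    intro x
    have h1 : w x + γ * x * deriv w x = 0 := by
      apply lh_lim γ _ (2 * g x * deriv w x) hγ
      filter_upwards [hE2 (-1) (by norm_num) x] with τ h
      rw [h]
      have : (fun Z => (U (-1) Z) ^ 2) = fun _ => 0 := by
        funext Z; rw [hU0 (-1) (by norm_num)]; simp
      rw [this]; simp
    field_simp
    linarith
  refine ⟨?_, ?_⟩
  · intro r z t h
    refine ⟨?_, ?_⟩
    · rw [hrepu r z t h, hU0 _ (hRneg r z t h), mul_zero]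
    · rw [hrepω r z t h, hweq _ (hRneg r z t h), hw0, mul_zero]
  · have hgd : Differentiable ℝ g := hg2.differentiable (by norm_num)
    have hg1 : Differentiable ℝ (deriv g) := by
      have : ContDiff ℝ (1 + 1) g := by simpa [one_add_one_eq_two] using hg2
      exact ((contDiff_succ_iff_deriv.1 this).2.2).differentiable (by norm_num)
    have hgz : ∀ Z, deriv (deriv g) Z = 0 := by
      intro Z
      have h1 := hWg (-1) (by norm_num) Z
      have h2 := hweq (-1) (by norm_num) Z
      rw [hw0] at h2
      linarith
    have hgc := is_const_of_deriv_eq_zero hg1 hgz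
    have hlin : ∀ Z, g Z = deriv g 0 * Z + g 0 := by
      intro Z
      have hd : Differentiable ℝ (fun Z => g Z - deriv g 0 * Z) := by fun_prop
      have hz : ∀ x, deriv (fun Z => g Z - deriv g 0 * Z) x = 0 := by
        intro x
        have h1 : HasDerivAt (fun Z => g Z - deriv g 0 * Z) (deriv g x - deriv g 0 * 1) x :=
          (hgd x).hasDerivAt.sub ((hasDerivAt_id x).const_mul _)
        rw [h1.deriv, hgc x 0]; ring
      have := is_const_of_deriv_eq_zero hd hz Z 0
      linarith
    refine ⟨deriv g 0, g 0, ?_⟩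
    intro r z t h
    have h0 : 0 < T - t := by linarith [hltT r z t h]
    rw [hψ' r z t h]
    simp only
    rw [hlin]
    have e : (T - t) ^ (-1 + 2 * γ) * (T - t) ^ (-γ) = (T - t) ^ (-1 + γ) := by
      rw [← Real.rpow_add h0]; ring_nf
    linear_combination (deriv g 0 * z) * e
end

section
/- Triviality of the reduced self-similar profile system. Let γ > 0, let U, Ω ∈ C¹(𝒟) and Ψ ∈ C²(𝒟), and suppose that at every point Y = (R,Z) of the interior of 𝒟 the following equations hold: (19) (1−γ/2)U + γ Y·∇U + ∇^⊥Ψ·∇U = 0; (20) Ω + γ Y·∇Ω + ∇^⊥Ψ·∇Ω = ∂_Z(U²); (21) −ΔΨ = Ω; (22) R ∇^⊥Ψ·∇U + 2Ψ ∂_Z U = 2U ∂_Z Ψ; (23) R ∇^⊥Ψ·∇Ω + 2Ψ ∂_Z Ω = 0; (24) ∂_R Ψ = 0. Assume the decay condition sup_{R ≤ 0} (|U(R,Z)| + |Ω(R,Z)|) → 0 as |Z| → ∞. Then U ≡ 0 and Ω ≡ 0 on 𝒟, and there exist constants a, b ∈ ℝ such that Ψ(R,Z) = aZ + b for all (R,Z)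 ∈ 𝒟. -/
/-- Partial derivative in the first variable. -/
noncomputable def pd1 (f : ℝ → ℝ → ℝ) : ℝ → ℝ → ℝ := fun x y => deriv (fun s => f s y) x

/-- Partial derivative in the second variable. -/
noncomputable def pd2 (f : ℝ → ℝ → ℝ) : ℝ → ℝ → ℝ := fun x y => deriv (fun s => f x s) y

theorem aux_bdry (f : ℝ → ℝ → ℝ)
    (hf : ContinuousOn (fun q : ℝ × ℝ => f q.1 q.2) {q : ℝ × ℝ | q.1 ≤ 0})
    (c Z : ℝ) (h : ∀ R < (0 : ℝ), f R Z = c) : ∀ R ≤ (0 : ℝ), f R Z = c := by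
  intro R hR
  rcases hR.lt_or_eq with h1 | rfl
  · exact h R h1
  have hc : ContinuousOn (fun s : ℝ => f s Z) (Set.Iic 0) :=
    hf.comp (f := fun s : ℝ => (s, Z)) (by fun_prop) (fun s hs => hs)
  have h2 : Filter.Tendsto (fun s : ℝ => f s Z) (nhdsWithin 0 (Set.Iio 0)) (nhds (f 0 Z)) :=
    (hc 0 (by simp)).mono_left (nhdsWithin_mono _ Set.Iio_subset_Iic_self)
  have h3 : Filter.Tendsto (fun s : ℝ => f s Z) (nhdsWithin 0 (Set.Iio 0)) (nhds c) := by
    refine tendsto_const_nhds.congr' ?_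
    filter_upwards [self_mem_nhdsWithin] with s hs
    exact (h s hs).symm
  exact tendsto_nhds_unique h2 h3

theorem aux_slice {n : WithTop ℕ∞} (f : ℝ → ℝ → ℝ)
    (hf : ContDiffOn ℝ n (fun q : ℝ × ℝ => f q.1 q.2) {q : ℝ × ℝ | q.1 ≤ 0})
    (R : ℝ) (hR : R ≤ 0) : ContDiff ℝ n (f R) := by
  rw [← contDiffOn_univ]
  exact hf.comp (f := fun s : ℝ => (R, s)) (by fun_prop) (fun s _ => hR)

theorem aux_zero (f : ℝ → ℝ) (c : ℝ) (hf : ∀ x, f x = c)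
    (hd : ∀ ε > 0, ∃ M : ℝ, ∀ Z : ℝ, M < |Z| → |f Z| < ε) : c = 0 := by
  by_contra hc
  obtain ⟨M, hM⟩ := hd |c| (abs_pos.mpr hc)
  have := hM (|M| + 1) (by
    rw [abs_of_nonneg (by positivity)]
    linarith [le_abs_self M])
  rw [hf] at this
  exact lt_irrefl _ this

/-- **Triviality of the reduced self-similar profile system.**
Let `γ > 0`, `U, Ω ∈ C¹(𝒟)`, `Ψ ∈ C²(𝒟)` on the closed left half-plane
`𝒟 = {(R,Z) : R ≤ 0}`, and suppose that equations (19)–(24) hold at every interior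
point `R < 0`:
(19) `(1−γ/2)U + γ Y·∇U + ∇^⊥Ψ·∇U = 0`;
(20) `Ω + γ Y·∇Ω + ∇^⊥Ψ·∇Ω = ∂_Z(U²)`;
(21) `−ΔΨ = Ω`;
(22) `R ∇^⊥Ψ·∇U + 2Ψ ∂_Z U = 2U ∂_Z Ψ`;
(23) `R ∇^⊥Ψ·∇Ω + 2Ψ ∂_Z Ω = 0`;
(24) `∂_R Ψ = 0`.
Assume `sup_{R ≤ 0} (|U(R,Z)| + |Ω(R,Z)|) → 0` as `|Z| → ∞`.  Then `U ≡ 0` and `Ω ≡ 0`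
on `𝒟`, and `Ψ(R,Z) = aZ + b` on `𝒟` for some constants `a, b`. -/
theorem profile_system_triviality
    (γ : ℝ) (hγ : 0 < γ)
    (U W Ψ : ℝ → ℝ → ℝ)
    (hU : ContDiffOn ℝ 1 (fun q : ℝ × ℝ => U q.1 q.2) {q : ℝ × ℝ | q.1 ≤ 0})
    (hW : ContDiffOn ℝ 1 (fun q : ℝ × ℝ => W q.1 q.2) {q : ℝ × ℝ | q.1 ≤ 0})
    (hΨ : ContDiffOn ℝ 2 (fun q : ℝ × ℝ => Ψ q.1 q.2) {q : ℝ × ℝ | q.1 ≤ 0})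
    (heq19 : ∀ R < (0 : ℝ), ∀ Z : ℝ,
      (1 - γ / 2) * U R Z + γ * (R * pd1 U R Z + Z * pd2 U R Z)
        + (-(pd2 Ψ R Z) * pd1 U R Z + pd1 Ψ R Z * pd2 U R Z) = 0)
    (heq20 : ∀ R < (0 : ℝ), ∀ Z : ℝ,
      W R Z + γ * (R * pd1 W R Z + Z * pd2 W R Z)
        + (-(pd2 Ψ R Z) * pd1 W R Z + pd1 Ψ R Z * pd2 W R Z)
        = pd2 (fun a b => (U a b) ^ 2) R Z)
    (heq21 : ∀ R < (0 : ℝ), ∀ Z : ℝ,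
      -(pd1 (pd1 Ψ) R Z + pd2 (pd2 Ψ) R Z) = W R Z)
    (heq22 : ∀ R < (0 : ℝ), ∀ Z : ℝ,
      R * (-(pd2 Ψ R Z) * pd1 U R Z + pd1 Ψ R Z * pd2 U R Z)
        + 2 * Ψ R Z * pd2 U R Z = 2 * U R Z * pd2 Ψ R Z)
    (heq23 : ∀ R < (0 : ℝ), ∀ Z : ℝ,
      R * (-(pd2 Ψ R Z) * pd1 W R Z + pd1 Ψ R Z * pd2 W R Z)
        + 2 * Ψ R Z * pd2 W R Z = 0)
    (heq24 : ∀ R < (0 : ℝ), ∀ Z : ℝ, pd1 Ψ R Z = 0)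
    (hdecay : ∀ ε > 0, ∃ M : ℝ, ∀ R ≤ (0 : ℝ), ∀ Z : ℝ,
      M < |Z| → |U R Z| + |W R Z| < ε) :
    (∀ R ≤ (0 : ℝ), ∀ Z : ℝ, U R Z = 0 ∧ W R Z = 0)
    ∧ ∃ a b : ℝ, ∀ R ≤ (0 : ℝ), ∀ Z : ℝ, Ψ R Z = a * Z + b := by
  have hΨ1 : ∀ Z, ∀ R ≤ (0 : ℝ), Ψ R Z = Ψ (-1) Z := by
    intro Z
    apply aux_bdry Ψ hΨ.continuousOn
    intro R hR
    have hdiff : DifferentiableOn ℝ (fun s : ℝ => Ψ s Z) (Set.Iio 0) :=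
      (hΨ.differentiableOn (by norm_num)).comp (f := fun s : ℝ => (s, Z)) (by fun_prop)
        (fun s hs => Set.mem_setOf_eq ▸ (Set.mem_Iio.mp hs).le)
    exact isOpen_Iio.is_const_of_deriv_eq_zero isPreconnected_Iio hdiff
      (fun s hs => heq24 s hs Z) hR (by simp)
  have hψ : ContDiff ℝ 2 (Ψ (-1)) := aux_slice Ψ hΨ _ (by norm_num)
  have hw : ContDiff ℝ 1 (W (-1)) := aux_slice W hW _ (by norm_num)
  have hWR : ∀ R < (0 : ℝ), ∀ Z, W R Z = -deriv (deriv (Ψ (-1))) Z := by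
    intro R hR Z
    rw [← heq21 R hR Z]
    have e1 : pd1 (pd1 Ψ) R Z = 0 := by
      have : (fun s => pd1 Ψ s Z) =ᶠ[nhds R] fun _ => 0 := by
        filter_upwards [Iio_mem_nhds hR] with s hs
        exact heq24 s hs Z
      unfold pd1 at this ⊢
      rw [this.deriv_eq]
      simp
    have e2 : pd2 (pd2 Ψ) R Z = deriv (deriv (Ψ (-1))) Z := by
      have : Ψ R = Ψ (-1) := funext fun z => hΨ1 z R hR.le
      unfold pd2
      simp only [this]
    rw [e1, e2, zero_add]
  have hW1 : ∀ Z, W (-1) Z = -deriv (deriv (Ψ (-1))) Z := hWR (-1) (by norm_num)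
  have hprod : ∀ Z, Ψ (-1) Z * deriv (W (-1)) Z = 0 := by
    intro Z
    have h := heq23 (-1) (by norm_num) Z
    have e1 : pd1 W (-1) Z = 0 := by
      have : (fun s => W s Z) =ᶠ[nhds (-1)] fun _ => W (-1) Z := by
        filter_upwards [Iio_mem_nhds (show (-1 : ℝ) < 0 by norm_num)] with s hs
        rw [hWR s hs, hW1]
      unfold pd1
      rw [this.deriv_eq]
      simp
    have e2 : pd2 W (-1) Z = deriv (W (-1)) Z := rfl
    rw [e1, heq24 (-1) (by norm_num) Z, e2] at h
    linarith
  have hw' : ∀ Z, deriv (W (-1)) Z = 0 := by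
    intro Z
    by_contra hne
    have hev : ∀ᶠ z in nhds Z, deriv (W (-1)) z ≠ 0 :=
      (hw.continuous_deriv le_rfl).continuousAt.eventually_ne hne
    have h0 : Ψ (-1) =ᶠ[nhds Z] fun _ => 0 := by
      filter_upwards [hev] with z hz
      exact (mul_eq_zero.mp (hprod z)).resolve_right hz
    have h2 := h0.deriv.deriv
    have h3 : W (-1) =ᶠ[nhds Z] fun _ => 0 := by
      filter_upwards [h2] with z hz
      rw [hW1, hz]
      simp
    apply hne
    rw [h3.deriv_eq]
    simp
  have hw0 : ∀ Z, W (-1) Z = 0 := by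
    have hc : ∀ Z, W (-1) Z = W (-1) 0 := fun Z =>
      is_const_of_deriv_eq_zero (hw.differentiable (by norm_num)) hw' Z 0
    have := aux_zero (W (-1)) _ hc (fun ε hε => by
      obtain ⟨M, hM⟩ := hdecay ε hε
      refine ⟨M, fun Z hZ => ?_⟩
      have := hM (-1) (by norm_num) Z hZ
      linarith [abs_nonneg (U (-1) Z)])
    intro Z
    rw [hc, this]
  have hWz : ∀ R < (0 : ℝ), ∀ Z, W R Z = 0 := by
    intro R hR Z
    rw [hWR R hR, ← hW1, hw0]
  have hUz : ∀ R < (0 : ℝ), ∀ Z, U R Z = 0 := by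
    intro R hR
    have hUs : Differentiable ℝ (U R) := (aux_slice U hU R hR.le).differentiable (by norm_num)
    have hd : ∀ Z, deriv (fun b => U R b ^ 2) Z = 0 := by
      intro Z
      have h := heq20 R hR Z
      have e1 : pd1 W R Z = 0 := by
        have : (fun s => W s Z) =ᶠ[nhds R] fun _ => 0 := by
          filter_upwards [Iio_mem_nhds hR] with s hs
          exact hWz s hs Z
        unfold pd1
        rw [this.deriv_eq]
        simp
      have e2 : pd2 W R Z = 0 := by
        have : (fun s => W R s) = fun _ => 0 := funext fun s => hWz R hR s
        unfold pd2
        rw [this]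
        simp
      rw [e1, e2, hWz R hR Z] at h
      unfold pd2 at h
      simp only at h
      rw [← h]
      ring
    have hc : ∀ Z, U R Z ^ 2 = U R 0 ^ 2 := fun Z =>
      is_const_of_deriv_eq_zero (f := fun b => U R b ^ 2) (hUs.pow 2) hd Z 0
    have hc' : ∀ Z, |U R Z| = |U R 0| := fun Z => sq_eq_sq_iff_abs_eq_abs _ _ |>.mp (hc Z)
    have := aux_zero (fun Z => |U R Z|) _ hc' (fun ε hε => by
      obtain ⟨M, hM⟩ := hdecay ε hε
      refine ⟨M, fun Z hZ => ?_⟩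
      have := hM R hR.le Z hZ
      rw [abs_abs]
      linarith [abs_nonneg (W R Z)])
    intro Z
    exact abs_eq_zero.mp ((hc' Z).trans this)
  refine ⟨fun R hR Z => ⟨aux_bdry U hU.continuousOn 0 Z (fun r hr => hUz r hr Z) R hR,
    aux_bdry W hW.continuousOn 0 Z (fun r hr => hWz r hr Z) R hR⟩, ?_⟩
  have hψd : Differentiable ℝ (Ψ (-1)) := hψ.differentiable (by norm_num)
  have hψ' : Differentiable ℝ (deriv (Ψ (-1))) := by
    have h2 : ContDiff ℝ (1 + 1) (Ψ (-1)) := by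
      rw [one_add_one_eq_two]
      exact hψ
    exact ((contDiff_succ_iff_deriv.mp h2).2.2).differentiable (by norm_num)
  have hda : ∀ Z, deriv (Ψ (-1)) Z = deriv (Ψ (-1)) 0 := fun Z =>
    is_const_of_deriv_eq_zero hψ' (fun z => by linarith [hW1 z, hw0 z]) Z 0
  refine ⟨deriv (Ψ (-1)) 0, Ψ (-1) 0, fun R hR Z => ?_⟩
  rw [hΨ1 Z R hR]
  have hder : ∀ z, HasDerivAt (fun z => Ψ (-1) z - deriv (Ψ (-1)) 0 * z) 0 z := by
    intro z
    have h1 := (hψd z).hasDerivAt.sub ((hasDerivAt_id z).const_mul (deriv (Ψ (-1)) 0))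
    rw [hda z] at h1
    have h2 : deriv (Ψ (-1)) 0 - deriv (Ψ (-1)) 0 * 1 = 0 := by ring
    rw [h2] at h1
    exact h1
  have := is_const_of_deriv_eq_zero (fun z => (hder z).differentiableAt)
    (fun z => (hder z).deriv) Z 0
  simp only [mul_zero, sub_zero] at this
  linarith
end

section
/- Triviality of the k-th order profile system (induction step of Theorem 2). Let γ > 0, let k ≥ 1 be an integer, set c₁ = 1 − γ/2 − kγ and c₂ = 1 − kγ, and let p be a positive even integer. Let 𝒟 = {(R,Z) ∈ ℝ² : R ≤ 0}, let U, Ω : 𝒟 → ℝ be C¹ up to the boundary and Ψ : 𝒟 → ℝ be C² up to the boundary. Suppose that on 𝒟: c₁ U + γ Y·∇U = 0; c₂ Ω + γ Y·∇Ω = 0; and −ΔΨ = Ω. Assume: |U(Y)| + |Ω(Y)| → 0 and |∇Ψ(Y)|/|Y| → 0 as |Y| → ∞ (Y ∈ 𝒟); ∂_Z Ψ(0,Z) = 0 for every Z ∈ ℝ; and ∫_{{Y ∈ 𝒟 : ρ < |Y| < 2ρ}} (U(Y)^p + Ω(Y)^p) dY → 0 as ρ → ∞. Then U ≡ 0 and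 Ω ≡ 0 on 𝒟, and there exist constants a, b ∈ ℝ with Ψ(R,Z) = aR + b on 𝒟. -/
open MeasureTheory Filter

theorem kop_pd {V : ℝ → ℝ → ℝ} {R Z : ℝ} {L : ℝ × ℝ →L[ℝ] ℝ}
    (h : HasFDerivAt (fun q : ℝ × ℝ => V q.1 q.2) L (R, Z)) :
    pd1 V R Z = L (1, 0) ∧ pd2 V R Z = L (0, 1) := by
  constructor
  · have h1 : HasDerivAt (fun s : ℝ => (s, Z)) ((1 : ℝ), (0 : ℝ)) R :=
      (hasDerivAt_id R).prodMk (hasDerivAt_const R Z)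
    exact (HasFDerivAt.comp_hasDerivAt (x := R) (f := fun s : ℝ => (s, Z)) h h1).deriv
  · have h1 : HasDerivAt (fun s : ℝ => (R, s)) ((0 : ℝ), (1 : ℝ)) Z :=
      (hasDerivAt_const Z R).prodMk (hasDerivAt_id Z)
    exact (HasFDerivAt.comp_hasDerivAt (x := Z) (f := fun s : ℝ => (R, s)) h h1).deriv

theorem kop_nhds {q : ℝ × ℝ} (hq : q.1 < 0) : {q : ℝ × ℝ | q.1 ≤ 0} ∈ nhds q := by
  filter_upwards [(isOpen_lt continuous_fst continuous_const).mem_nhds hq] with x hx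
  exact le_of_lt hx

theorem kop_homog (γ c : ℝ) (hγ : 0 < γ) (V : ℝ → ℝ → ℝ)
    (hV : ContDiffOn ℝ 1 (fun q : ℝ × ℝ => V q.1 q.2) {q : ℝ × ℝ | q.1 ≤ 0})
    (heq : ∀ R ≤ (0 : ℝ), ∀ Z : ℝ,
      c * V R Z + γ * (R * pd1 V R Z + Z * pd2 V R Z) = 0)
    (hdecay : ∀ ε > 0, ∃ M : ℝ, ∀ R ≤ (0 : ℝ), ∀ Z : ℝ,
      M < Real.sqrt (R ^ 2 + Z ^ 2) → |V R Z| < ε) :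
    ∀ R ≤ (0 : ℝ), ∀ Z : ℝ, V R Z = 0 := by
  have hcont := hV.continuousOn
  have key : ∀ R < (0 : ℝ), ∀ Z : ℝ, V R Z = 0 := by
    intro R hR Z
    set β := c / γ with hβ
    have hd : ∀ t ∈ Set.Ioi (0:ℝ), HasDerivAt (fun t : ℝ => t ^ β * V (t * R) (t * Z)) 0 t := by
      intro t ht
      have ht : 0 < t := ht
      have htR : t * R < 0 := mul_neg_of_pos_of_neg ht hR
      have hdf : DifferentiableAt ℝ (fun q : ℝ × ℝ => V q.1 q.2) (t * R, t * Z) :=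
        (hV.contDiffAt (kop_nhds htR)).differentiableAt (by norm_num)
      obtain ⟨e1, e2⟩ := kop_pd hdf.hasFDerivAt
      set L := fderiv ℝ (fun q : ℝ × ℝ => V q.1 q.2) (t * R, t * Z)
      have h1 : HasDerivAt (fun s : ℝ => (s * R, s * Z)) (R, Z) t := by
        simpa using ((hasDerivAt_id t).mul_const R).prodMk ((hasDerivAt_id t).mul_const Z)
      have h2 : HasDerivAt (fun s : ℝ => V (s * R) (s * Z)) (L (R, Z)) t :=
        HasFDerivAt.comp_hasDerivAt (x := t) (f := fun s : ℝ => (s * R, s * Z))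
          hdf.hasFDerivAt h1
      have h3 := (Real.hasDerivAt_rpow_const (p := β) (Or.inl ht.ne')).mul h2
      have hL : L (R, Z) = R * L (1, 0) + Z * L (0, 1) := by
        have : (R, Z) = R • ((1 : ℝ), (0 : ℝ)) + Z • ((0 : ℝ), (1 : ℝ)) := by simp
        rw [this, map_add, map_smul, map_smul]; rfl
      have h4 := heq (t * R) htR.le (t * Z)
      rw [e1, e2] at h4
      have h5 : t * L (R, Z) = - β * V (t * R) (t * Z) := by
        rw [hL, hβ]; field_simp; linarith
      have h6 : t ^ β = t ^ (β - 1) * t := by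
        rw [← Real.rpow_add_one ht.ne']; ring_nf
      have h7 : β * t ^ (β - 1) * V (t * R) (t * Z) + t ^ β * L (R, Z) = 0 := by
        rw [h6]
        linear_combination (t ^ (β - 1)) * h5
      rw [h7] at h3
      exact h3
    have hconst : ∀ t > (0:ℝ), t ^ β * V (t * R) (t * Z) = V R Z := by
      intro t ht
      have := isOpen_Ioi.is_const_of_deriv_eq_zero (isPreconnected_Ioi)
        (fun x hx => (hd x hx).differentiableAt.differentiableWithinAt)
        (fun x hx => (hd x hx).deriv) (show t ∈ Set.Ioi (0:ℝ) from ht)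
        (show (1:ℝ) ∈ Set.Ioi (0:ℝ) from Set.mem_Ioi.2 one_pos)
      simpa using this
    rcases lt_or_ge 0 β with hb | hb
    · have t1 : Tendsto (fun t : ℝ => t ^ β) (nhdsWithin 0 (Set.Ioi 0)) (nhds 0) := by
        have := (Real.continuousAt_rpow_const 0 β (Or.inr hb.le)).tendsto
        rw [Real.zero_rpow hb.ne'] at this
        exact this.mono_left nhdsWithin_le_nhds
      have t2 : Tendsto (fun t : ℝ => V (t * R) (t * Z)) (nhdsWithin 0 (Set.Ioi 0))
          (nhds (V 0 0)) := by
        have c0 := hcont (0, 0) (by simp)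
        refine Tendsto.comp (f := fun t : ℝ => (t * R, t * Z)) c0 ?_
        refine tendsto_nhdsWithin_iff.2 ⟨?_, ?_⟩
        · have : Continuous (fun t : ℝ => (t * R, t * Z)) := by fun_prop
          have := this.tendsto 0
          simp only [zero_mul] at this
          exact this.mono_left nhdsWithin_le_nhds
        · filter_upwards [self_mem_nhdsWithin] with t ht
          exact (mul_neg_of_pos_of_neg ht hR).le
      have t3 := t1.mul t2
      rw [zero_mul] at t3
      refine tendsto_nhds_unique (Tendsto.congr' ?_ tendsto_const_nhds) t3
      filter_upwards [self_mem_nhdsWithin] with t ht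
      exact (hconst t ht).symm
    · by_contra hne
      obtain ⟨M, hM⟩ := hdecay |V R Z| (abs_pos.2 hne)
      have hr : 0 < Real.sqrt (R ^ 2 + Z ^ 2) := Real.sqrt_pos.2 (by nlinarith [sq_nonneg Z, mul_pos_of_neg_of_neg hR hR])
      set r := Real.sqrt (R ^ 2 + Z ^ 2) with hrdef
      set t := max 1 ((M + 1) / r) with htdef
      have ht1 : 1 ≤ t := le_max_left _ _
      have ht0 : 0 < t := by linarith
      have hs : Real.sqrt ((t * R) ^ 2 + (t * Z) ^ 2) = t * r := by
        rw [hrdef, show (t * R) ^ 2 + (t * Z) ^ 2 = t ^ 2 * (R ^ 2 + Z ^ 2) by ring,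
          Real.sqrt_mul (by positivity), Real.sqrt_sq ht0.le]
      have hlt : M < t * r := by
        have : (M + 1) / r ≤ t := le_max_right _ _
        rw [div_le_iff₀ hr] at this
        linarith
      have h1 := hM (t * R) (mul_neg_of_pos_of_neg ht0 hR).le (t * Z) (by rw [hs]; exact hlt)
      have h2 : t ^ β ≤ 1 := Real.rpow_le_one_of_one_le_of_nonpos ht1 hb
      have h3 : 0 < t ^ β := Real.rpow_pos_of_pos ht0 _
      have h4 := hconst t ht0
      have h5 : |V R Z| = t ^ β * |V (t * R) (t * Z)| := by
        rw [← h4, abs_mul, abs_of_pos h3]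
      nlinarith [abs_nonneg (V (t * R) (t * Z))]
  intro R hR Z
  have c0 := hcont (R, Z) hR
  have t2 : Tendsto (fun t : ℝ => V (R - t) Z) (nhdsWithin 0 (Set.Ioi 0)) (nhds (V R Z)) := by
    refine Tendsto.comp (f := fun t : ℝ => (R - t, Z)) c0 ?_
    refine tendsto_nhdsWithin_iff.2 ⟨?_, ?_⟩
    · have : Continuous (fun t : ℝ => (R - t, Z)) := by fun_prop
      have := this.tendsto 0
      simp only [sub_zero] at this
      exact this.mono_left nhdsWithin_le_nhds
    · filter_upwards [self_mem_nhdsWithin] with t ht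
      have : 0 < t := ht
      show R - t ≤ 0
      linarith
  refine tendsto_nhds_unique t2 (Tendsto.congr' ?_ tendsto_const_nhds)
  filter_upwards [self_mem_nhdsWithin] with t ht
  have : 0 < t := ht
  exact (key (R - t) (by linarith) Z).symm


theorem kop_entire (F : ℂ → ℂ) (hF : Differentiable ℂ F)
    (hg : ∀ ε > 0, ∃ M : ℝ, ∀ z : ℂ, M < ‖z‖ → ‖F z‖ ≤ ε * ‖z‖) (z w : ℂ) : F z = F w := by
  refine is_const_of_deriv_eq_zero hF (fun c => ?_) z w
  rw [← norm_le_zero_iff]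
  refine le_of_forall_pos_le_add fun ε hε => ?_
  obtain ⟨M, hM⟩ := hg (ε / 2) (by positivity)
  set r := |M| + ‖c‖ + 1
  have hr : 0 < r := by positivity
  have h := Complex.norm_deriv_le_of_forall_mem_sphere_norm_le (c := c) (R := r)
    (C := ε * r) hr hF.diffContOnCl (fun z hz => by
      have hz : ‖z - c‖ = r := by simpa [dist_eq_norm] using hz
      have h1 : r ≤ ‖z‖ + ‖c‖ := hz ▸ norm_sub_le z c
      have h2 : ‖z‖ ≤ r + ‖c‖ := by
        have := norm_add_le (z - c) c
        rw [sub_add_cancel, hz] at this; exact this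
      have h3 := hM z (by linarith [le_abs_self M])
      have h4 : ‖c‖ ≤ r := by linarith [abs_nonneg M]
      nlinarith)
  rw [mul_div_cancel_right₀ _ hr.ne'] at h
  linarith

theorem kop_harm (g : ℂ → ℝ) (D : Set ℂ) (hD : D = {z : ℂ | z.re ≤ 0})
    (hg : ContDiffOn ℝ 2 g D)
    (hlap : ∀ z : ℂ, z.re < 0 → fderivWithin ℝ (fderivWithin ℝ g D) D z 1 1
      + fderivWithin ℝ (fderivWithin ℝ g D) D z Complex.I Complex.I = 0)
    (hbc : ∀ z : ℂ, z.re = 0 → fderivWithin ℝ g D z Complex.I = 0)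
    (hgr : ∀ ε > 0, ∃ M : ℝ, ∀ z : ℂ, z.re < 0 → M < ‖z‖ →
      Real.sqrt ((fderivWithin ℝ g D z 1) ^ 2 + (fderivWithin ℝ g D z Complex.I) ^ 2)
        ≤ ε * ‖z‖) :
    ∃ a b : ℝ, ∀ z ∈ D, g z = a * z.re + b := by
  have hconv : Convex ℝ D := hD ▸ convex_halfSpace_re_le 0
  have hint : interior D = {z : ℂ | z.re < 0} := hD ▸ Complex.interior_setOfPred_re_le 0
  have hclo : closure (interior D) = D := by
    rw [hint, hD]; exact Complex.closure_setOfPred_re_lt 0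
  have hnb : ∀ z : ℂ, z.re < 0 → D ∈ nhds z := fun z hz =>
    mem_interior_iff_mem_nhds.1 (by rw [hint]; exact hz)
  have huniq : UniqueDiffOn ℝ D := uniqueDiffOn_convex hconv (by
    rw [hint]; exact ⟨-1, by simp⟩)
  set G := fderivWithin ℝ g D with hG
  set H := fderivWithin ℝ G D with hH
  have hGc : ContDiffOn ℝ 1 G D := hg.fderivWithin huniq (by norm_num)
  have hHc : ContinuousOn H D := hGc.continuousOn_fderivWithin huniq (by norm_num)
  have hGd : ∀ z ∈ D, HasFDerivWithinAt G (H z) D z := fun z hz =>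
    ((hGc.differentiableOn (by norm_num)) z hz).hasFDerivWithinAt
  have hsymm : ∀ z ∈ D, H z Complex.I 1 = H z 1 Complex.I := fun z hz =>
    (hg z hz).isSymmSndFDerivWithinAt (by simp) huniq (by rw [hclo]; exact hz) hz _ _
  have hlap' : ∀ z ∈ D, H z 1 1 + H z Complex.I Complex.I = 0 := by
    have c1 : ContinuousOn (fun z => H z 1 1 + H z Complex.I Complex.I) D := by fun_prop
    refine Set.EqOn.of_subset_closure (s := interior D) (t := D) (g := fun _ => (0:ℝ)) ?_ c1
      continuousOn_const interior_subset hclo.ge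
    intro z hz
    rw [hint] at hz
    exact hlap z hz
  set f : ℂ → ℂ := fun z => (G z 1 : ℂ) - Complex.I * (G z Complex.I : ℂ) with hf
  have hfc : ContinuousOn f D := by
    have := hGc.continuousOn
    have c1 : ContinuousOn (fun z => G z 1) D := by fun_prop
    have c2 : ContinuousOn (fun z => G z Complex.I) D := by fun_prop
    exact (Complex.continuous_ofReal.comp_continuousOn c1).sub
      (continuousOn_const.mul (Complex.continuous_ofReal.comp_continuousOn c2))
  have hfd : ∀ z ∈ D, HasDerivWithinAt f ((H z 1 1 : ℂ) - Complex.I * (H z 1 Complex.I : ℂ)) D z := by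
    intro z hz
    have d1 : ∀ v : ℂ, HasFDerivWithinAt (fun z => (G z v : ℂ))
        (Complex.ofRealCLM.comp ((H z).flip v)) D z := by
      intro v
      have := (hGd z hz).clm_apply (hasFDerivWithinAt_const v z D)
      have h2 := Complex.ofRealCLM.hasFDerivAt.comp_hasFDerivWithinAt z this
      have e : Complex.ofRealCLM.comp ((G z).comp (0 : ℂ →L[ℝ] ℂ) + (H z).flip v)
          = Complex.ofRealCLM.comp ((H z).flip v) := by simp
      exact e ▸ h2
    have d2 := (d1 1).sub ((d1 Complex.I).const_mul Complex.I)
    rw [hasDerivWithinAt_iff_hasFDerivWithinAt]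
    refine HasFDerivWithinAt.of_restrictScalars ℝ d2 ?_
    have e1 := hsymm z hz
    have e2 : H z Complex.I Complex.I = - H z 1 1 := by linarith [hlap' z hz]
    ext w
    have hw : H z w = w.re • H z 1 + w.im • H z Complex.I := by
      rw [← map_smul, ← map_smul, ← map_add]; congr 1
      apply Complex.ext <;> simp
    apply Complex.ext <;> simp [hw, e1, e2] <;> ring
  have hbd : ∀ z : ℂ, z.re = 0 → H z 1 1 = 0 := by
    intro z hz
    have hzD : z ∈ D := by rw [hD]; exact hz.le
    have h1 : HasDerivAt (fun t : ℝ => z + t * Complex.I) Complex.I 0 := by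
      have := ((Complex.ofRealCLM.hasDerivAt (x := 0)).mul_const Complex.I).const_add z
      simpa using this
    have h2 := (hGd z hzD).clm_apply (hasFDerivWithinAt_const Complex.I z D)
    have h3 := HasFDerivWithinAt.comp_hasDerivWithinAt (x := (0:ℝ)) (s := Set.univ)
      (f := fun t : ℝ => z + t * Complex.I) (t := D) (by simpa using h2) h1.hasDerivWithinAt
      (fun t _ => by rw [hD]; simp [hz])
    have h4 : ((fun z => G z Complex.I) ∘ fun t : ℝ => z + t * Complex.I) = fun _ => (0:ℝ) := by
      funext t
      exact hbc _ (by simp [hz])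
    rw [h4, hasDerivWithinAt_univ] at h3
    have h5 := h3.unique (hasDerivAt_const 0 0)
    have := hlap' z hzD
    simp at h5
    linarith
  -- reflection
  set σ : ℂ → ℂ := fun z => - (starRingEnd ℂ) z with hσ
  set f2 : ℂ → ℂ := fun z => (starRingEnd ℂ) (f (σ z)) with hf2
  set E : Set ℂ := {z : ℂ | 0 ≤ z.re} with hE
  have hσE : ∀ z ∈ E, σ z ∈ D := fun z hz => by
    rw [hD]; simpa [hσ, hE] using hz
  have hf2d : ∀ z ∈ E, HasDerivWithinAt f2
      (-(starRingEnd ℂ) ((H (σ z) 1 1 : ℂ) - Complex.I * (H (σ z) 1 Complex.I : ℂ))) E z := by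
    intro z hz
    have h1 := ((hasDerivWithinAt_iff_hasFDerivWithinAt.1 (hfd (σ z) (hσE z hz))).restrictScalars ℝ)
    have h2 : HasFDerivWithinAt σ (-(Complex.conjCLE : ℂ →L[ℝ] ℂ)) E z :=
      (Complex.conjCLE.hasFDerivAt.neg).hasFDerivWithinAt
    have h3 := (Complex.conjCLE : ℂ →L[ℝ] ℂ).hasFDerivAt.comp_hasFDerivWithinAt z
      (h1.comp z h2 hσE)
    rw [hasDerivWithinAt_iff_hasFDerivWithinAt]
    refine HasFDerivWithinAt.of_restrictScalars ℝ h3 ?_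
    ext w
    simp
    ring
  set F : ℂ → ℂ := fun z => if z.re ≤ 0 then f z else f2 z with hFdef
  have hFD : ∀ z ∈ D, F z = f z := fun z hz => by
    rw [hD] at hz; exact if_pos hz
  have hFE : ∀ z ∈ E, F z = f2 z := by
    intro z hz
    by_cases h : z.re ≤ 0
    · have h0 : z.re = 0 := le_antisymm h hz
      have hs : σ z = z := by apply Complex.ext <;> simp [hσ, h0]
      simp only [hFdef, if_pos h, hf2, hs, hf, hbc z h0]
      simp
    · exact if_neg h
  have hFdiff : Differentiable ℂ F := by
    intro z
    rcases lt_trichotomy z.re 0 with h | h | h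
    · have hz : z ∈ D := by rw [hD]; exact h.le
      exact (((hfd z hz).congr hFD (hFD z hz)).hasDerivAt (hnb z h)).differentiableAt
    · have hz : z ∈ D := by rw [hD]; exact h.le
      have hz' : z ∈ E := h.ge
      have hs : σ z = z := by apply Complex.ext <;> simp [hσ, h]
      have h1 := (hfd z hz).congr hFD (hFD z hz)
      have h2 := (hf2d z hz').congr hFE (hFE z hz')
      rw [hs, hbd z h] at h2
      rw [hbd z h] at h1
      have h3 := h1.union (t := E) (by convert h2 using 1; simp)
      have hu : D ∪ E = Set.univ := by
        rw [hD, hE]; ext w; simpa using le_total w.re 0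
      rw [hu, hasDerivWithinAt_univ] at h3
      exact h3.differentiableAt
    · have hz : z ∈ E := h.le
      have hn : E ∈ nhds z := by
        filter_upwards [(isOpen_lt continuous_const Complex.continuous_re).mem_nhds h] with x hx
        exact le_of_lt hx
      exact (((hf2d z hz).congr hFE (hFE z hz)).hasDerivAt hn).differentiableAt
  have hfn : ∀ z, ‖f z‖ = Real.sqrt ((G z 1) ^ 2 + (G z Complex.I) ^ 2) := by
    intro z
    rw [Complex.norm_def, Complex.normSq_apply]
    simp [hf, sq]
  have hgF : ∀ ε > 0, ∃ M : ℝ, ∀ z : ℂ, M < ‖z‖ → ‖F z‖ ≤ ε * ‖z‖ := by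
    intro ε hε
    obtain ⟨M, hM⟩ := hgr ε hε
    have hne : ∀ z : ℂ, z.re ≠ 0 → M < ‖z‖ → ‖F z‖ ≤ ε * ‖z‖ := by
      intro z hz hMz
      rcases lt_or_gt_of_ne hz with h | h
      · rw [hFD z (by rw [hD]; exact h.le), hfn]; exact hM z h hMz
      · rw [hFE z h.le]
        have hn : ‖σ z‖ = ‖z‖ := by simp [hσ]
        have := hM (σ z) (by simpa [hσ] using h) (by rw [hn]; exact hMz)
        rw [← hfn, hn] at this
        simpa [hf2] using this
    refine ⟨M, fun z hz => ?_⟩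
    by_cases h : z.re = 0
    · have hcl : z ∈ closure {z : ℂ | z.re < 0} := by
        rw [Complex.closure_setOfPred_re_lt]; exact h.le
      have : (nhdsWithin z {z : ℂ | z.re < 0}).NeBot := mem_closure_iff_nhdsWithin_neBot.1 hcl
      have hc : Continuous F := hFdiff.continuous
      have t1 : Tendsto (fun z => ‖F z‖) (nhdsWithin z {z : ℂ | z.re < 0}) (nhds ‖F z‖) :=
        (hc.norm.tendsto z).mono_left nhdsWithin_le_nhds
      have t2 : Tendsto (fun z : ℂ => ε * ‖z‖) (nhdsWithin z {z : ℂ | z.re < 0})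
          (nhds (ε * ‖z‖)) :=
        ((continuous_const.mul continuous_norm).tendsto z).mono_left nhdsWithin_le_nhds
      refine le_of_tendsto_of_tendsto t1 t2 ?_
      have hn : ∀ᶠ w in nhdsWithin z {z : ℂ | z.re < 0}, M < ‖w‖ :=
        nhdsWithin_le_nhds ((isOpen_lt continuous_const continuous_norm).mem_nhds hz)
      filter_upwards [hn, self_mem_nhdsWithin] with w hw hw2
      exact hne w (ne_of_lt hw2) hw
    · exact hne z h hz
  have hconst := kop_entire F hFdiff hgF
  have h0D : (0:ℂ) ∈ D := by rw [hD]; simp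
  have hfz : ∀ z ∈ D, G z 1 = G 0 1 ∧ G z Complex.I = 0 := by
    intro z hz
    have h1 := hconst z 0
    rw [hFD z hz, hFD 0 h0D] at h1
    have h2 := hbc 0 (by simp)
    have r1 := congrArg Complex.re h1
    have r2 := congrArg Complex.im h1
    simp [hf, h2] at r1 r2
    exact ⟨r1, r2⟩
  refine ⟨G 0 1, g 0, fun z hz => ?_⟩
  have hdg : ∀ z ∈ D, HasFDerivWithinAt (fun z => g z - G 0 1 * z.re) (0 : ℂ →L[ℝ] ℝ) D z := by
    intro z hz
    have h1 : HasFDerivWithinAt g (G z) D z :=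
      ((hg.differentiableOn (by norm_num)) z hz).hasFDerivWithinAt
    have h2 : HasFDerivWithinAt (fun z : ℂ => G 0 1 * z.re) (G 0 1 • Complex.reCLM) D z :=
      (Complex.reCLM.hasFDerivAt.const_mul (G 0 1)).hasFDerivWithinAt
    have h3 := h1.sub h2
    suffices e : G z - G 0 1 • Complex.reCLM = 0 by
      rw [e] at h3; exact h3
    ext w
    have hw : G z w = w.re • G z 1 + w.im • G z Complex.I := by
      rw [← map_smul, ← map_smul, ← map_add]; congr 1
      apply Complex.ext <;> simp
    simp only [sub_apply, hw, smul_eq_mul, (hfz z hz).1, (hfz z hz).2]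
    simp; ring
  have := hconv.is_const_of_fderivWithin_eq_zero
    (fun z hz => (hdg z hz).differentiableWithinAt)
    (fun z hz => (hdg z hz).fderivWithin (huniq z hz)) hz h0D
  simp at this
  linarith

theorem kop_pdc {V : ℝ → ℝ → ℝ} {z : ℂ} {L : ℂ →L[ℝ] ℝ}
    (h : HasFDerivAt (fun q : ℂ => V q.re q.im) L z) :
    pd1 V z.re z.im = L 1 ∧ pd2 V z.re z.im = L Complex.I := by
  have h1 : HasFDerivAt (fun q : ℝ × ℝ => Complex.equivRealProdCLM.symm q)
      (Complex.equivRealProdCLM.symm : ℝ × ℝ →L[ℝ] ℂ) (z.re, z.im) :=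
    Complex.equivRealProdCLM.symm.hasFDerivAt
  have hz : Complex.equivRealProdCLM.symm (z.re, z.im) = z := by
    apply Complex.ext <;> simp
  have h2 := HasFDerivAt.comp (x := (z.re, z.im))
    (f := fun q : ℝ × ℝ => Complex.equivRealProdCLM.symm q)
    (g := fun q : ℂ => V q.re q.im) (g' := L) (by rw [hz]; exact h) h1
  have h3 : HasFDerivAt (fun q : ℝ × ℝ => V q.1 q.2)
      (L.comp (Complex.equivRealProdCLM.symm : ℝ × ℝ →L[ℝ] ℂ)) (z.re, z.im) := by
    have e : (fun q : ℂ => V q.re q.im) ∘ (fun q : ℝ × ℝ => Complex.equivRealProdCLM.symm q)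
        = fun q : ℝ × ℝ => V q.1 q.2 := by
      funext q; simp
    rw [← e]; exact h2
  have h4 := kop_pd h3
  have e1 : Complex.equivRealProdCLM.symm (1, 0) = 1 := by
    apply Complex.ext <;> simp
  have e2 : Complex.equivRealProdCLM.symm (0, 1) = Complex.I := by
    apply Complex.ext <;> simp
  simpa [e1, e2] using h4

theorem kop_psi (Ψ : ℝ → ℝ → ℝ)
    (hΨ : ContDiffOn ℝ 2 (fun q : ℝ × ℝ => Ψ q.1 q.2) {q : ℝ × ℝ | q.1 ≤ 0})
    (heqΨ : ∀ R ≤ (0 : ℝ), ∀ Z : ℝ, pd1 (pd1 Ψ) R Z + pd2 (pd2 Ψ) R Z = 0)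
    (hgrad : ∀ ε > 0, ∃ M : ℝ, ∀ R ≤ (0 : ℝ), ∀ Z : ℝ,
      M < Real.sqrt (R ^ 2 + Z ^ 2) →
      Real.sqrt ((pd1 Ψ R Z) ^ 2 + (pd2 Ψ R Z) ^ 2) ≤ ε * Real.sqrt (R ^ 2 + Z ^ 2))
    (hbc : ∀ Z : ℝ, pd2 Ψ 0 Z = 0) :
    ∃ a b : ℝ, ∀ R ≤ (0 : ℝ), ∀ Z : ℝ, Ψ R Z = a * R + b := by
  set D : Set ℂ := {z : ℂ | z.re ≤ 0} with hD
  set g : ℂ → ℝ := fun z => Ψ z.re z.im with hgdef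
  have hg : ContDiffOn ℝ 2 g D :=
    ContDiffOn.comp (g := fun q : ℝ × ℝ => Ψ q.1 q.2) (f := fun z : ℂ => Complex.equivRealProdCLM z)
      hΨ (Complex.equivRealProdCLM.contDiff.contDiffOn) (fun z hz => by simpa [hD] using hz)
  have hnb : ∀ z : ℂ, z.re < 0 → D ∈ nhds z := fun z hz => by
    filter_upwards [(isOpen_lt Complex.continuous_re continuous_const).mem_nhds hz] with x hx
    exact le_of_lt hx
  have huniq : UniqueDiffOn ℝ D := uniqueDiffOn_convex (convex_halfSpace_re_le 0) (by
    rw [hD, Complex.interior_setOfPred_re_le]; exact ⟨-1, by simp⟩)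
  have hGc : ContDiffOn ℝ 1 (fderivWithin ℝ g D) D := hg.fderivWithin huniq (by norm_num)
  have hgd : ∀ z ∈ D, HasFDerivWithinAt g (fderivWithin ℝ g D z) D z := fun z hz =>
    ((hg.differentiableOn (by norm_num)) z hz).hasFDerivWithinAt
  have hpd : ∀ z : ℂ, z.re < 0 → pd1 Ψ z.re z.im = fderivWithin ℝ g D z 1 ∧
      pd2 Ψ z.re z.im = fderivWithin ℝ g D z Complex.I := fun z hz =>
    kop_pdc ((hgd z hz.le).hasFDerivAt (hnb z hz))
  have hpd2 : ∀ z : ℂ, z.re < 0 →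
      pd1 (pd1 Ψ) z.re z.im = fderivWithin ℝ (fderivWithin ℝ g D) D z 1 1 ∧
      pd2 (pd2 Ψ) z.re z.im = fderivWithin ℝ (fderivWithin ℝ g D) D z Complex.I Complex.I := by
    intro z hz
    have hGd : HasFDerivAt (fderivWithin ℝ g D) (fderivWithin ℝ (fderivWithin ℝ g D) D z) z :=
      (((hGc.differentiableOn (by norm_num)) z hz.le).hasFDerivWithinAt).hasFDerivAt (hnb z hz)
    have hev : ∀ᶠ w : ℂ in nhds z, w.re < 0 :=
      (isOpen_lt Complex.continuous_re continuous_const).mem_nhds hz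
    have d : ∀ v : ℂ, HasFDerivAt (fun w => fderivWithin ℝ g D w v)
        ((fderivWithin ℝ (fderivWithin ℝ g D) D z).flip v) z := fun v => by
      simpa using hGd.clm_apply (hasFDerivAt_const v z)
    constructor
    · have := (d 1).congr_of_eventuallyEq (f₁ := fun w : ℂ => pd1 Ψ w.re w.im)
        (hev.mono fun w hw => (hpd w hw).1)
      simpa using (kop_pdc this).1
    · have := (d Complex.I).congr_of_eventuallyEq (f₁ := fun w : ℂ => pd2 Ψ w.re w.im)
        (hev.mono fun w hw => (hpd w hw).2)
      simpa using (kop_pdc this).2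
  have hnorm : ∀ z : ℂ, ‖z‖ = Real.sqrt (z.re ^ 2 + z.im ^ 2) := fun z => by
    rw [Complex.norm_def, Complex.normSq_apply, sq, sq]
  obtain ⟨a, b, hab⟩ := kop_harm g D hD hg
    (fun z hz => by
      rw [← (hpd2 z hz).1, ← (hpd2 z hz).2]; exact heqΨ _ hz.le _)
    (fun z hz => by
      have h1 : HasDerivAt (fun t : ℝ => (t : ℂ) * Complex.I) Complex.I z.im := by
        simpa using (Complex.ofRealCLM.hasDerivAt (x := z.im)).mul_const Complex.I
      have e : (z.im : ℂ) * Complex.I = z := by apply Complex.ext <;> simp [hz]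
      have h3 := HasFDerivWithinAt.comp_hasDerivWithinAt (x := z.im) (s := Set.univ)
        (f := fun t : ℝ => (t : ℂ) * Complex.I) (t := D) (l := g) (l' := fderivWithin ℝ g D z)
        (by rw [e]; exact hgd z hz.le) h1.hasDerivWithinAt (fun t _ => by simp [hD])
      rw [hasDerivWithinAt_univ] at h3
      have h4 : (g ∘ fun t : ℝ => (t : ℂ) * Complex.I) = fun t => Ψ 0 t := by
        funext t; simp [hgdef]
      rw [h4] at h3
      rw [← h3.deriv]
      exact hbc z.im)
    (fun ε hε => by
      obtain ⟨M, hM⟩ := hgrad ε hε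
      refine ⟨M, fun z hz hMz => ?_⟩
      rw [hnorm] at hMz ⊢
      rw [← (hpd z hz).1, ← (hpd z hz).2]
      exact hM _ hz.le _ hMz)
  exact ⟨a, b, fun R hR Z => hab ⟨R, Z⟩ hR⟩

/-- **Triviality of the `k`-th order profile system (induction step of Theorem 2).**
Let `γ > 0`, `k ≥ 1` an integer, `c₁ = 1 − γ/2 − kγ`, `c₂ = 1 − kγ`, and `p` a positive
even integer.  Let `U, Ω ∈ C¹(𝒟)`, `Ψ ∈ C²(𝒟)` on `𝒟 = {(R,Z) : R ≤ 0}` satisfy on `𝒟`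
`c₁ U + γ Y·∇U = 0`, `c₂ Ω + γ Y·∇Ω = 0`, `−ΔΨ = Ω`.  Assume the decay of `U, Ω`, the
sublinearity of `∇Ψ`, the boundary condition `∂_Z Ψ(0,Z) = 0`, and the vanishing of the
annulus integrals of `U^p + Ω^p`.  Then `U ≡ 0`, `Ω ≡ 0` and `Ψ(R,Z) = aR + b` on `𝒟`
for some constants `a, b`. -/
theorem kth_order_profile_triviality
    (γ : ℝ) (hγ : 0 < γ) (k : ℕ) (hk : 1 ≤ k)
    (c₁ c₂ : ℝ) (hc₁ : c₁ = 1 - γ / 2 - (k : ℝ) * γ) (hc₂ : c₂ = 1 - (k : ℝ) * γ)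
    (p : ℕ) (hp : 0 < p) (hpeven : Even p)
    (U W Ψ : ℝ → ℝ → ℝ)
    (hU : ContDiffOn ℝ 1 (fun q : ℝ × ℝ => U q.1 q.2) {q : ℝ × ℝ | q.1 ≤ 0})
    (hW : ContDiffOn ℝ 1 (fun q : ℝ × ℝ => W q.1 q.2) {q : ℝ × ℝ | q.1 ≤ 0})
    (hΨ : ContDiffOn ℝ 2 (fun q : ℝ × ℝ => Ψ q.1 q.2) {q : ℝ × ℝ | q.1 ≤ 0})
    (heqU : ∀ R ≤ (0 : ℝ), ∀ Z : ℝ,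
      c₁ * U R Z + γ * (R * pd1 U R Z + Z * pd2 U R Z) = 0)
    (heqW : ∀ R ≤ (0 : ℝ), ∀ Z : ℝ,
      c₂ * W R Z + γ * (R * pd1 W R Z + Z * pd2 W R Z) = 0)
    (heqΨ : ∀ R ≤ (0 : ℝ), ∀ Z : ℝ,
      -(pd1 (pd1 Ψ) R Z + pd2 (pd2 Ψ) R Z) = W R Z)
    (hdecay : ∀ ε > 0, ∃ M : ℝ, ∀ R ≤ (0 : ℝ), ∀ Z : ℝ,
      M < Real.sqrt (R ^ 2 + Z ^ 2) → |U R Z| + |W R Z| < ε)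
    (hgrad : ∀ ε > 0, ∃ M : ℝ, ∀ R ≤ (0 : ℝ), ∀ Z : ℝ,
      M < Real.sqrt (R ^ 2 + Z ^ 2) →
      Real.sqrt ((pd1 Ψ R Z) ^ 2 + (pd2 Ψ R Z) ^ 2) ≤ ε * Real.sqrt (R ^ 2 + Z ^ 2))
    (hbc : ∀ Z : ℝ, pd2 Ψ 0 Z = 0)
    (hint : Tendsto (fun ρ : ℝ =>
      ∫ q in {q : ℝ × ℝ | q.1 ≤ 0 ∧ ρ < Real.sqrt (q.1 ^ 2 + q.2 ^ 2)
                ∧ Real.sqrt (q.1 ^ 2 + q.2 ^ 2) < 2 * ρ},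
        ((U q.1 q.2) ^ p + (W q.1 q.2) ^ p))
      atTop (nhds 0)) :
    (∀ R ≤ (0 : ℝ), ∀ Z : ℝ, U R Z = 0 ∧ W R Z = 0)
    ∧ ∃ a b : ℝ, ∀ R ≤ (0 : ℝ), ∀ Z : ℝ, Ψ R Z = a * R + b := by
  have hU0 := kop_homog γ c₁ hγ U hU heqU (fun ε hε => by
    obtain ⟨M, hM⟩ := hdecay ε hε
    exact ⟨M, fun R hR Z h => by linarith [hM R hR Z h, abs_nonneg (W R Z)]⟩)
  have hW0 := kop_homog γ c₂ hγ W hW heqW (fun ε hε => by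
    obtain ⟨M, hM⟩ := hdecay ε hε
    exact ⟨M, fun R hR Z h => by linarith [hM R hR Z h, abs_nonneg (U R Z)]⟩)
  refine ⟨fun R hR Z => ⟨hU0 R hR Z, hW0 R hR Z⟩, ?_⟩
  exact kop_psi Ψ hΨ (fun R hR Z => by
    have := heqΨ R hR Z
    rw [hW0 R hR Z] at this
    linarith) hgrad hbc
end

section
/- Energy-based growth bound for the self-similar profile. Let T ∈ ℝ, 0 < δ < 1/2, γ > 0 and C > 0. Let U : 𝒟 → ℝ be continuous on the left half-plane 𝒟, and for t ∈ (T−δ, T) define u^θ(r,z,t) = r (T−t)^{−1+γ/2} U((r−1)(T−t)^{−γ}, z(T−t)^{−γ}). Suppose that ∫_{−δ}^{δ} ∫_{1−δ}^{1} |u^θ(r,z,t)|² dr dz ≤ C for every t ∈ (T−δ, T). Then for every L > δ^{1−γ}, ∫_{−L}^{0} ∫_{−L}^{L} |U(R,Z)|² dZ dR ≤ 4 C δ^{(2/γ)−3} L^{3−2/γ}. -/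
/-- **Energy-based growth bound for the self-similar profile.**
Let `T ∈ ℝ`, `0 < δ < 1/2`, `γ > 0`, `C > 0`.  Let `U` be continuous on the closed left
half-plane and for `t ∈ (T−δ, T)` set
`u^θ(r,z,t) = r (T−t)^{−1+γ/2} U((r−1)(T−t)^{−γ}, z(T−t)^{−γ})` (real powers).
If `∫_{−δ}^{δ} ∫_{1−δ}^{1} |u^θ(r,z,t)|² dr dz ≤ C` for every `t ∈ (T−δ, T)`, then for
every `L > δ^{1−γ}`,
`∫_{−L}^{0} ∫_{−L}^{L} |U(R,Z)|² dZ dR ≤ 4 C δ^{2/γ − 3} L^{3 − 2/γ}`. -/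
theorem energy_growth_bound_profile
    (T δ γ C : ℝ) (hδ0 : 0 < δ) (hδ : δ < 1 / 2) (hγ : 0 < γ) (hC : 0 < C)
    (U : ℝ → ℝ → ℝ)
    (hUcont : ContinuousOn (fun q : ℝ × ℝ => U q.1 q.2) {q : ℝ × ℝ | q.1 ≤ 0})
    (henergy : ∀ t ∈ Set.Ioo (T - δ) T,
      (∫ z in (-δ)..δ, ∫ r in (1 - δ)..1,
        |r * (T - t) ^ (-1 + γ / 2) *
          U ((r - 1) * (T - t) ^ (-γ)) (z * (T - t) ^ (-γ))| ^ 2) ≤ C) :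
    ∀ L : ℝ, δ ^ ((1 : ℝ) - γ) < L →
      (∫ R in (-L)..(0 : ℝ), ∫ Z in (-L)..L, |U R Z| ^ 2)
        ≤ 4 * C * δ ^ (2 / γ - 3) * L ^ (3 - 2 / γ) := by
  intro L hL
  have hL0 : 0 < L := lt_trans (Real.rpow_pos_of_pos hδ0 _) hL
  set q : ℝ := δ / L with hq
  have hq0 : 0 < q := div_pos hδ0 hL0
  set s : ℝ := q ^ (1 / γ) with hs
  have hs0 : 0 < s := Real.rpow_pos_of_pos hq0 _
  have hqδ : q < δ ^ γ := by
    rw [hq, div_lt_iff₀ hL0]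
    calc δ = δ ^ γ * δ ^ (1 - γ) := by
            rw [← Real.rpow_add hδ0]; simp
      _ < δ ^ γ * L := by
            apply mul_lt_mul_of_pos_left hL (Real.rpow_pos_of_pos hδ0 _)
  have hsδ : s < δ := by
    calc s < (δ ^ γ) ^ (1 / γ) := Real.rpow_lt_rpow hq0.le hqδ (by positivity)
      _ = δ := by
        rw [← Real.rpow_mul hδ0.le, mul_one_div_cancel hγ.ne', Real.rpow_one]
  have hsγ : s ^ (-γ) = q⁻¹ := by
    rw [hs, ← Real.rpow_mul hq0.le]
    have : 1 / γ * -γ = -1 := by field_simp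
    rw [this, Real.rpow_neg_one]
  have hE := henergy (T - s) ⟨by linarith, by linarith⟩
  rw [sub_sub_cancel, hsγ] at hE
  set a : ℝ := s ^ (-1 + γ / 2) with ha
  have ha2 : a ^ 2 = q ^ (1 - 2 / γ) := by
    rw [ha, hs, ← Real.rpow_natCast, ← Real.rpow_mul hq0.le, ← Real.rpow_mul hq0.le]
    congr 1
    push_cast
    field_simp
    ring
  obtain ⟨V, hV, hVU⟩ : ∃ V : ℝ → ℝ → ℝ, Continuous (fun p : ℝ × ℝ => V p.1 p.2) ∧
      ∀ R Z, R ≤ 0 → V R Z = U R Z := by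
    refine ⟨fun R Z => U (min R 0) Z, ?_, fun R Z h => by simp [h]⟩
    have h1 : Continuous (fun p : ℝ × ℝ => ((min p.1 0, p.2) : ℝ × ℝ)) := by fun_prop
    exact hUcont.comp_continuous h1 (fun p => by simp)
  have hV' : ∀ f g : ℝ × ℝ → ℝ, Continuous f → Continuous g →
      Continuous (fun p => V (f p) (g p)) := fun f g hf hg => hV.comp (hf.prodMk hg)
  have hcq : (0 : ℝ) < q⁻¹ := inv_pos.mpr hq0
  have hδq : q⁻¹ * δ = L := by rw [hq]; field_simp
  -- lower bound
  have hlow : (∫ z in (-δ)..δ, ∫ r in (1 - δ)..1,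
        (a ^ 2 / 4) * V (q⁻¹ * r - q⁻¹) (q⁻¹ * z) ^ 2) ≤
      ∫ z in (-δ)..δ, ∫ r in (1 - δ)..1,
        |r * a * U ((r - 1) * q⁻¹) (z * q⁻¹)| ^ 2 := by
    have heq : (∫ z in (-δ)..δ, ∫ r in (1 - δ)..1,
        |r * a * U ((r - 1) * q⁻¹) (z * q⁻¹)| ^ 2) =
        ∫ z in (-δ)..δ, ∫ r in (1 - δ)..1,
          r ^ 2 * a ^ 2 * V (q⁻¹ * r - q⁻¹) (q⁻¹ * z) ^ 2 := by
      apply intervalIntegral.integral_congr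
      intro z _
      apply intervalIntegral.integral_congr
      intro r hr
      rw [Set.uIcc_of_le (by linarith)] at hr
      have h0 : q⁻¹ * r - q⁻¹ ≤ 0 := by nlinarith [hr.2]
      simp only
      rw [hVU _ _ h0, sq_abs, mul_comm z, show (r - 1) * q⁻¹ = q⁻¹ * r - q⁻¹ by ring]
      ring
    rw [heq]
    have c1 : Continuous (fun p : ℝ × ℝ =>
        (a ^ 2 / 4) * V (q⁻¹ * p.2 - q⁻¹) (q⁻¹ * p.1) ^ 2) :=
      continuous_const.mul ((hV' _ _ (by fun_prop) (by fun_prop)).pow 2)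
    have c2 : Continuous (fun p : ℝ × ℝ =>
        p.2 ^ 2 * a ^ 2 * V (q⁻¹ * p.2 - q⁻¹) (q⁻¹ * p.1) ^ 2) :=
      Continuous.mul (by fun_prop) ((hV' _ _ (by fun_prop) (by fun_prop)).pow 2)
    apply intervalIntegral.integral_mono_on (by linarith)
    · apply Continuous.intervalIntegrable
      exact intervalIntegral.continuous_parametric_intervalIntegral_of_continuous' c1 _ _
    · apply Continuous.intervalIntegrable
      exact intervalIntegral.continuous_parametric_intervalIntegral_of_continuous' c2 _ _
    · intro z _
      apply intervalIntegral.integral_mono_on (by linarith)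
      · exact (c1.comp (Continuous.prodMk_right z)).intervalIntegrable _ _
      · exact (c2.comp (Continuous.prodMk_right z)).intervalIntegrable _ _
      · intro r hr
        apply mul_le_mul_of_nonneg_right _ (sq_nonneg _)
        have : 1 / 4 ≤ r ^ 2 := by nlinarith [hr.1]
        nlinarith [sq_nonneg a]
  have hcov : (∫ z in (-δ)..δ, ∫ r in (1 - δ)..1,
        (a ^ 2 / 4) * V (q⁻¹ * r - q⁻¹) (q⁻¹ * z) ^ 2) =
      a ^ 2 / 4 * (q * (q * ∫ Z in (-L)..L, ∫ R in (-L)..(0 : ℝ), V R Z ^ 2)) := by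
    have h1 : ∀ z, (∫ r in (1 - δ)..1, (a ^ 2 / 4) * V (q⁻¹ * r - q⁻¹) (q⁻¹ * z) ^ 2) =
        a ^ 2 / 4 * (q * ∫ R in (-L)..(0 : ℝ), V R (q⁻¹ * z) ^ 2) := by
      intro z
      rw [intervalIntegral.integral_const_mul,
        intervalIntegral.integral_comp_mul_sub (fun R => V R (q⁻¹ * z) ^ 2) hcq.ne', inv_inv,
        smul_eq_mul, show q⁻¹ * (1 - δ) - q⁻¹ = -L by rw [← hδq]; ring,
        show q⁻¹ * 1 - q⁻¹ = 0 by ring]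
    simp_rw [h1]
    rw [intervalIntegral.integral_const_mul, intervalIntegral.integral_const_mul,
      intervalIntegral.integral_comp_mul_left
        (fun Z => ∫ R in (-L)..(0 : ℝ), V R Z ^ 2) hcq.ne', inv_inv,
        smul_eq_mul, mul_neg, hδq]
  have hswap : (∫ R in (-L)..(0 : ℝ), ∫ Z in (-L)..L, |U R Z| ^ 2) =
      ∫ Z in (-L)..L, ∫ R in (-L)..(0 : ℝ), V R Z ^ 2 := by
    have e1 : (∫ R in (-L)..(0 : ℝ), ∫ Z in (-L)..L, |U R Z| ^ 2) =
        ∫ R in (-L)..(0 : ℝ), ∫ Z in (-L)..L, V R Z ^ 2 := by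
      apply intervalIntegral.integral_congr
      intro R hR
      rw [Set.uIcc_of_le (by linarith)] at hR
      simp only [sq_abs, hVU _ _ hR.2]
    rw [e1]
    simp only [intervalIntegral.integral_of_le (show -L ≤ 0 by linarith),
      intervalIntegral.integral_of_le (show -L ≤ L by linarith)]
    apply MeasureTheory.integral_integral_swap
    rw [MeasureTheory.Measure.prod_restrict]
    have hc : Continuous (Function.uncurry fun R Z => V R Z ^ 2) := hV.pow 2
    have hK : IsCompact (Set.Icc (-L) 0 ×ˢ Set.Icc (-L) L) := isCompact_Icc.prod isCompact_Icc
    exact (hc.continuousOn.integrableOn_compact hK).mono_set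
      (Set.prod_mono Set.Ioc_subset_Icc_self Set.Ioc_subset_Icc_self)
  rw [hswap]
  set I := ∫ Z in (-L)..L, ∫ R in (-L)..(0 : ℝ), V R Z ^ 2
  have hfin : a ^ 2 / 4 * (q * (q * I)) ≤ C := by
    rw [← hcov]; exact hlow.trans hE
  have hpow : q ^ (3 - 2 / γ) = a ^ 2 * q ^ 2 := by
    rw [ha2, ← Real.rpow_natCast q 2, ← Real.rpow_add hq0]
    congr 1; push_cast; ring
  have hq3 : q ^ (3 - 2 / γ) = δ ^ (3 - 2 / γ) / L ^ (3 - 2 / γ) := by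
    rw [hq, Real.div_rpow hδ0.le hL0.le]
  have hneg : δ ^ (2 / γ - 3) = (δ ^ (3 - 2 / γ))⁻¹ := by
    rw [← Real.rpow_neg hδ0.le]; congr 1; ring
  have hD := Real.rpow_pos_of_pos hδ0 (3 - 2 / γ)
  have hM := Real.rpow_pos_of_pos hL0 (3 - 2 / γ)
  have hk : δ ^ (3 - 2 / γ) / L ^ (3 - 2 / γ) * I ≤ 4 * C := by
    rw [← hq3, hpow]; linarith
  rw [hneg]
  rw [div_mul_eq_mul_div, div_le_iff₀ hM] at hk
  rw [mul_right_comm, ← div_eq_mul_inv, le_div_iff₀ hD]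
  linarith
end
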